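/- arXiv:1407.0967 — 5 statements merged into one kernel-verified Lean document; each statement's English description precedes it below -/
import Mathlib

section
/- Let p > 3 be a prime. Then for every integer x, ∑_{k=0}^{p-1} g_k(x)·(1 − p²·H_k^{(2)}) ≡ ∑_{k=0}^{p-1} (p/(2k+1))·(1 − 2p²·H_k^{(2)})·x^k (mod p⁴). -/
/-- `g n x = ∑_{k=0}^n (n choose k)² (2k choose k) xᵏ`. -/
def g (x : ℤ) (n : ℕ) : ℤ :=
  ∑ k ∈ Finset.range (n + 1), (n.choose k : ℤ) ^ 2 * ((2 * k).choose k : ℤ) * x ^ k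

/-- Harmonic number of order 2: `H_k^{(2)} = ∑_{j=1}^k 1/j²`. -/
def H2 (k : ℕ) : ℚ := ∑ j ∈ Finset.range k, 1 / ((j : ℚ) + 1) ^ 2

/-- For rationals, `a ≡ b (mod p^m)` means the p-adic valuation of `a - b` is at least `m`. -/
def ratCongr (p m : ℕ) (a b : ℚ) : Prop :=
  a = b ∨ (m : ℤ) ≤ padicValRat p (a - b)

theorem sum_neg_one_pow_choose_mul_choose (N a M : ℕ) :
    ∑ j ∈ Finset.range (N + 1), (-1 : ℚ) ^ j * (N.choose j : ℚ) * ((a + j).choose (M + N) : ℚ) =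
      (-1) ^ N * (a.choose M : ℚ) := by
  induction N generalizing a M with
  | zero => simp
  | succ N ih =>
    have h1 := ih a (M + 1)
    have h2 := ih (a + 1) (M + 1)
    have key : ∑ j ∈ Finset.range (N + 1 + 1),
        (-1 : ℚ) ^ j * ((N + 1).choose j : ℚ) * ((a + j).choose (M + (N + 1)) : ℚ) =
        (∑ j ∈ Finset.range (N + 1),
          (-1 : ℚ) ^ j * (N.choose j : ℚ) * ((a + j).choose (M + 1 + N) : ℚ)) -
        ∑ j ∈ Finset.range (N + 1),
          (-1 : ℚ) ^ j * (N.choose j : ℚ) * ((a + 1 + j).choose (M + 1 + N) : ℚ) := by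
      have h3 : ∑ j ∈ Finset.range (N + 1),
          (-1 : ℚ) ^ j * (N.choose j : ℚ) * ((a + j).choose (M + 1 + N) : ℚ) =
          ∑ j ∈ Finset.range (N + 1 + 1),
          (-1 : ℚ) ^ j * (N.choose j : ℚ) * ((a + j).choose (M + 1 + N) : ℚ) := by
        rw [Finset.sum_range_succ _ (N + 1)]
        simp
      rw [h3, Finset.sum_range_succ', Finset.sum_range_succ' _ (N + 1), add_sub_right_comm,
        ← Finset.sum_sub_distrib]
      congr 1
      · refine Finset.sum_congr rfl fun j _ => ?_
        rw [Nat.choose_succ_succ, show a + 1 + j = a + (j + 1) by ring,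
          show M + 1 + N = M + (N + 1) by ring]
        push_cast
        ring
      · simp [show M + 1 + N = M + (N + 1) by ring]
    rw [key, h1, h2, Nat.choose_succ_succ]
    push_cast
    ring

/-- The product `∏_{j=1}^n (1 - p²/j²)`. -/
def prodOneSub (p n : ℕ) : ℚ := ∏ j ∈ Finset.range n, (1 - (p : ℚ) ^ 2 / ((j : ℚ) + 1) ^ 2)

theorem prodOneSub_eq (m n : ℕ) (hn : n ≤ m) :
    prodOneSub (m + 1) n = (-1) ^ n * (m.choose n : ℚ) * ((m + 1 + n).choose n : ℚ) := by
  induction n with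
  | zero => simp [prodOneSub]
  | succ n ih =>
    have h := ih (by omega)
    unfold prodOneSub at h ⊢
    rw [Finset.prod_range_succ, h]
    have h1 : (m.choose (n + 1) : ℚ) * (n + 1) = m.choose n * (m - n) := by
      have := Nat.choose_succ_right_eq m n
      rw [← Nat.cast_sub (by omega)]
      exact_mod_cast this
    have h2 : ((m + 1 + (n + 1)).choose (n + 1) : ℚ) * (n + 1) =
        (m + 1 + n + 1) * (m + 1 + n).choose n := by
      have := Nat.add_one_mul_choose_eq (m + 1 + n) n
      exact_mod_cast this.symm
    have hn0 : (n : ℚ) + 1 ≠ 0 := by positivity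
    rw [eq_div_of_mul_eq hn0 h1, eq_div_of_mul_eq hn0 h2]
    field_simp
    push_cast
    ring

theorem choose_mul_choose_mul_central (k N : ℕ) :
    ((2 * k + 1 + N).choose (2 * k + 1) : ℚ) * ((2 * k).choose k : ℚ) * (2 * k + 1) =
      (k + N + 1) * ((k + N).choose k : ℚ) * ((2 * k + 1 + N).choose k : ℚ) := by
  have e : 2 * k + 1 + N = k + (k + N + 1) := by ring
  rw [Nat.cast_add_choose ℚ (a := 2 * k + 1) (b := N), Nat.cast_add_choose ℚ (a := k) (b := N),
    two_mul k, Nat.cast_add_choose ℚ (a := k) (b := k), ← two_mul, e,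
    Nat.cast_add_choose ℚ (a := k) (b := k + N + 1), Nat.factorial_succ (2 * k),
    Nat.factorial_succ (k + N)]
  push_cast
  field_simp

theorem central_mul_sum_choose_sq_mul_prodOneSub (k N : ℕ) (h : Even (k + N)) :
    ((2 * k).choose k : ℚ) *
      ∑ n ∈ Finset.range (k + N + 1), (n.choose k : ℚ) ^ 2 * prodOneSub (k + N + 1) n =
      ((k + N + 1 : ℕ) : ℚ) / (2 * k + 1) * prodOneSub (k + N + 1) k ^ 2 := by
  have h0 : ∑ n ∈ Finset.range k, (n.choose k : ℚ) ^ 2 * prodOneSub (k + N + 1) n = 0 :=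
    Finset.sum_eq_zero fun n hn => by
      rw [Nat.choose_eq_zero_of_lt (Finset.mem_range.1 hn)]; simp
  have h1 : ∀ j ∈ Finset.range (N + 1),
      ((k + j).choose k : ℚ) ^ 2 * prodOneSub (k + N + 1) (k + j) =
      ((-1) ^ k * ((k + N).choose k : ℚ) * ((2 * k + 1 + N).choose k : ℚ)) *
      ((-1 : ℚ) ^ j * (N.choose j : ℚ) * ((2 * k + 1 + N + j).choose (2 * k + 1 + N) : ℚ)) := by
    intro j hj
    have hj' : j ≤ N := by simpa [Nat.lt_succ_iff] using hj
    rw [prodOneSub_eq _ _ (by omega)]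
    have e1 : ((k + N).choose (k + j) : ℚ) * (k + j).choose k = (k + N).choose k * N.choose j := by
      have := Nat.choose_mul (n := k + N) (k := k + j) (s := k) (by omega)
      simp only [Nat.add_sub_cancel_left] at this
      exact_mod_cast this
    have e2 : ((k + N + 1 + (k + j)).choose (k + j) : ℚ) * (k + j).choose k =
        (2 * k + 1 + N + j).choose (2 * k + 1 + N) * (2 * k + 1 + N).choose k := by
      have := Nat.choose_mul (n := k + N + 1 + (k + j)) (k := k + j) (s := j)
        (by omega)
      rw [show k + N + 1 + (k + j) - j = 2 * k + 1 + N by omega, show k + j - j = k by omega,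
        ← Nat.choose_symm_add (a := k) (b := j),
        show k + N + 1 + (k + j) = 2 * k + 1 + N + j by ring,
        ← Nat.choose_symm_add (a := 2 * k + 1 + N) (b := j)] at this
      rw [show k + N + 1 + (k + j) = 2 * k + 1 + N + j by ring]
      exact_mod_cast this
    rw [pow_add]
    linear_combination (-1) ^ k * (-1) ^ j * ((k + N + 1 + (k + j)).choose (k + j) : ℚ) *
      (k + j).choose k * e1 + (-1) ^ k * (-1) ^ j * ((k + N).choose k : ℚ) * N.choose j * e2
  rw [add_assoc k N 1, Finset.sum_range_add, ← add_assoc k N 1, h0, zero_add,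
    Finset.sum_congr rfl h1, ← Finset.mul_sum, sum_neg_one_pow_choose_mul_choose,
    prodOneSub_eq _ _ (by omega)]
  have h2 := choose_mul_choose_mul_central k N
  have h3 : (-1 : ℚ) ^ k * (-1) ^ N = 1 := by rw [← pow_add, h.neg_one_pow]
  have h4 : ((-1 : ℚ) ^ k) ^ 2 = 1 := by rw [← pow_mul, mul_comm, pow_mul]; simp
  rw [show k + N + 1 + k = 2 * k + 1 + N by ring]
  have hk : (2 * (k : ℚ) + 1) ≠ 0 := by positivity
  rw [div_mul_eq_mul_div, eq_div_iff hk, mul_pow, mul_pow, h4]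
  push_cast
  linear_combination ((2 * k).choose k : ℚ) * (k + N).choose k * (2 * k + 1 + N).choose k *
    (2 * k + 1 + N).choose (2 * k + 1) * (2 * k + 1) * h3 +
    ((k + N).choose k : ℚ) * (2 * k + 1 + N).choose k * h2

theorem g_eq_sum_range (x : ℤ) {n p : ℕ} (hn : n < p) :
    (g x n : ℚ) = ∑ k ∈ Finset.range p,
      (n.choose k : ℚ) ^ 2 * ((2 * k).choose k : ℚ) * (x : ℚ) ^ k := by
  unfold g
  push_cast
  refine Finset.sum_subset (Finset.range_mono (by omega)) fun k _ hk => ?_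
  rw [Nat.choose_eq_zero_of_lt (by simpa using hk)]
  simp

theorem sum_g_mul_prodOneSub {p : ℕ} (hp : Odd p) (x : ℤ) :
    ∑ n ∈ Finset.range p, (g x n : ℚ) * prodOneSub p n =
      ∑ k ∈ Finset.range p, (p : ℚ) / (2 * k + 1) * prodOneSub p k ^ 2 * (x : ℚ) ^ k := by
  have h : ∀ n ∈ Finset.range p, (g x n : ℚ) * prodOneSub p n = ∑ k ∈ Finset.range p,
      (n.choose k : ℚ) ^ 2 * ((2 * k).choose k : ℚ) * (x : ℚ) ^ k * prodOneSub p n := by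
    intro n hn
    rw [g_eq_sum_range x (Finset.mem_range.1 hn), Finset.sum_mul]
  rw [Finset.sum_congr rfl h, Finset.sum_comm]
  refine Finset.sum_congr rfl fun k hk => ?_
  obtain ⟨N, rfl⟩ := Nat.exists_eq_add_of_lt (Finset.mem_range.1 hk)
  rw [← central_mul_sum_choose_sq_mul_prodOneSub k N (by
    simpa [Nat.odd_add_one] using hp), Finset.mul_sum, Finset.sum_mul]
  exact Finset.sum_congr rfl fun n _ => by ring

/-- The subring of `p`-integral rational numbers. -/
noncomputable def padicIntegral (p : ℕ) [Fact p.Prime] : Subring ℚ :=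
  (PadicInt.subring p).comap (Rat.castHom ℚ_[p])

section PadicIntegral

variable {p : ℕ} [Fact p.Prime]

theorem mem_padicIntegral {q : ℚ} : q ∈ padicIntegral p ↔ padicNorm p q ≤ 1 := by
  change ‖(q : ℚ_[p])‖ ≤ 1 ↔ _
  rw [Padic.eq_padicNorm]
  exact_mod_cast Iff.rfl

theorem one_div_natCast_mem_padicIntegral {n : ℕ} (hn : ¬ p ∣ n) :
    1 / (n : ℚ) ∈ padicIntegral p := by
  rw [mem_padicIntegral, padicNorm.div, padicNorm.nat_eq_one_iff n |>.2 hn]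
  simp

theorem one_div_add_one_sq_mem_padicIntegral {n : ℕ} (hn : n + 1 < p) :
    1 / ((n : ℚ) + 1) ^ 2 ∈ padicIntegral p := by
  have := one_div_natCast_mem_padicIntegral (p := p) (n := n + 1)
    (Nat.not_dvd_of_pos_of_lt n.succ_pos hn)
  have := pow_mem this 2
  rw [div_pow, one_pow] at this
  exact_mod_cast this

theorem H2_mem_padicIntegral {n : ℕ} (hn : n < p) : H2 n ∈ padicIntegral p :=
  sum_mem fun j hj => one_div_add_one_sq_mem_padicIntegral (by
    have := Finset.mem_range.1 hj
    omega)

theorem exists_prodOneSub_eq {n : ℕ} (hn : n < p) :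
    ∃ s ∈ padicIntegral p, prodOneSub p n = 1 - (p : ℚ) ^ 2 * H2 n + (p : ℚ) ^ 4 * s := by
  induction n with
  | zero => exact ⟨0, zero_mem _, by simp [prodOneSub, H2]⟩
  | succ n ih =>
    obtain ⟨s, hs, h⟩ := ih (by omega)
    have ht := one_div_add_one_sq_mem_padicIntegral hn
    have hp : (p : ℚ) ∈ padicIntegral p := natCast_mem _ p
    refine ⟨s * (1 - (p : ℚ) ^ 2 * (1 / ((n : ℚ) + 1) ^ 2)) + H2 n * (1 / ((n : ℚ) + 1) ^ 2),
      add_mem (mul_mem hs (sub_mem (one_mem _) (mul_mem (pow_mem hp 2) ht)))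
        (mul_mem (H2_mem_padicIntegral (by omega)) ht), ?_⟩
    have e1 : prodOneSub p (n + 1) =
        prodOneSub p n * (1 - (p : ℚ) ^ 2 * (1 / ((n : ℚ) + 1) ^ 2)) := by
      rw [prodOneSub, Finset.prod_range_succ, mul_one_div, prodOneSub]
    have e2 : H2 (n + 1) = H2 n + 1 / ((n : ℚ) + 1) ^ 2 := by
      rw [H2, Finset.sum_range_succ, H2]
    rw [e1, e2, h]
    ring

theorem exists_prodOneSub_sq_eq {n : ℕ} (hn : n < p) :
    ∃ s ∈ padicIntegral p,
      prodOneSub p n ^ 2 = 1 - 2 * (p : ℚ) ^ 2 * H2 n + (p : ℚ) ^ 4 * s := by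
  obtain ⟨s, hs, h⟩ := exists_prodOneSub_eq hn
  have hp : (p : ℚ) ∈ padicIntegral p := natCast_mem _ p
  have hH := H2_mem_padicIntegral hn
  have h2 : (2 : ℚ) ∈ padicIntegral p := ofNat_mem _ 2
  refine ⟨H2 n ^ 2 + s * (2 * (1 - (p : ℚ) ^ 2 * H2 n) + (p : ℚ) ^ 4 * s),
    add_mem (pow_mem hH 2) (mul_mem hs (add_mem (mul_mem h2 (sub_mem (one_mem _)
      (mul_mem (pow_mem hp 2) hH))) (mul_mem (pow_mem hp 4) hs))), ?_⟩
  rw [h]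
  ring

theorem natCast_div_two_mul_add_one_mem_padicIntegral {k : ℕ} (hk : k < p) :
    (p : ℚ) / (2 * k + 1) ∈ padicIntegral p := by
  by_cases h : p ∣ 2 * k + 1
  · obtain ⟨c, hc⟩ := h
    have hc1 : c = 1 := by
      have : c < 2 := by
        by_contra! h2
        have := Nat.mul_le_mul_left p h2
        omega
      interval_cases c <;> omega
    have : (2 * (k : ℚ) + 1) = p := by
      rw [hc1, mul_one] at hc
      exact_mod_cast hc
    rw [this, div_self (by exact_mod_cast (Fact.out : p.Prime).ne_zero)]
    exact one_mem _
  · have := mul_mem (natCast_mem (padicIntegral p) p) (one_div_natCast_mem_padicIntegral h)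
    rw [mul_one_div] at this
    exact_mod_cast this

theorem ratCongr_of_sub_eq {m : ℕ} {a b s : ℚ} (hs : s ∈ padicIntegral p)
    (h : a - b = (p : ℚ) ^ m * s) : ratCongr p m a b := by
  by_cases h0 : a - b = 0
  · exact Or.inl (sub_eq_zero.1 h0)
  · right
    have hs0 : s ≠ 0 := by rintro rfl; simp [h] at h0
    have hp1 : (1 : ℚ) < p := by exact_mod_cast (Fact.out : p.Prime).one_lt
    rw [h, padicValRat.mul (by positivity) hs0, padicValRat.pow p,
      padicValRat.self (Fact.out : p.Prime).one_lt]
    rw [mem_padicIntegral, padicNorm.eq_zpow_of_nonzero hs0, ← zpow_zero (p : ℚ),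
      zpow_le_zpow_iff_right₀ hp1] at hs
    linarith

end PadicIntegral

theorem sum_g_mod_p4 (p : ℕ) (hp : p.Prime) (hp3 : 3 < p) (x : ℤ) :
    ratCongr p 4
      (∑ k ∈ Finset.range p, (g x k : ℚ) * (1 - (p : ℚ) ^ 2 * H2 k))
      (∑ k ∈ Finset.range p,
        ((p : ℚ) / (2 * (k : ℚ) + 1)) * (1 - 2 * (p : ℚ) ^ 2 * H2 k) * (x : ℚ) ^ k) := by
  have : Fact p.Prime := ⟨hp⟩
  have hs : ∀ k : ℕ, ∃ s ∈ padicIntegral p, k < p →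
      prodOneSub p k = 1 - (p : ℚ) ^ 2 * H2 k + (p : ℚ) ^ 4 * s := fun k => by
    by_cases hk : k < p
    · obtain ⟨s, hs, h⟩ := exists_prodOneSub_eq hk
      exact ⟨s, hs, fun _ => h⟩
    · exact ⟨0, zero_mem _, fun h => absurd h hk⟩
  have ht : ∀ k : ℕ, ∃ s ∈ padicIntegral p, k < p →
      prodOneSub p k ^ 2 = 1 - 2 * (p : ℚ) ^ 2 * H2 k + (p : ℚ) ^ 4 * s := fun k => by
    by_cases hk : k < p
    · obtain ⟨s, hs, h⟩ := exists_prodOneSub_sq_eq hk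
      exact ⟨s, hs, fun _ => h⟩
    · exact ⟨0, zero_mem _, fun h => absurd h hk⟩
  choose s hs hsP using hs
  choose t ht htP using ht
  have key := sum_g_mul_prodOneSub (hp.odd_of_ne_two (by omega)) x
  have hL : ∑ k ∈ Finset.range p, (g x k : ℚ) * prodOneSub p k =
      ∑ k ∈ Finset.range p, (g x k : ℚ) * (1 - (p : ℚ) ^ 2 * H2 k) +
        (p : ℚ) ^ 4 * ∑ k ∈ Finset.range p, (g x k : ℚ) * s k := by
    rw [Finset.mul_sum, ← Finset.sum_add_distrib]
    refine Finset.sum_congr rfl fun k hk => ?_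
    rw [hsP k (Finset.mem_range.1 hk)]
    ring
  have hR : ∑ k ∈ Finset.range p, (p : ℚ) / (2 * k + 1) * prodOneSub p k ^ 2 * (x : ℚ) ^ k =
      ∑ k ∈ Finset.range p,
        ((p : ℚ) / (2 * (k : ℚ) + 1)) * (1 - 2 * (p : ℚ) ^ 2 * H2 k) * (x : ℚ) ^ k +
        (p : ℚ) ^ 4 * ∑ k ∈ Finset.range p, (p : ℚ) / (2 * k + 1) * t k * (x : ℚ) ^ k := by
    rw [Finset.mul_sum, ← Finset.sum_add_distrib]
    refine Finset.sum_congr rfl fun k hk => ?_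
    rw [htP k (Finset.mem_range.1 hk)]
    ring
  refine ratCongr_of_sub_eq
    (s := ∑ k ∈ Finset.range p, (p : ℚ) / (2 * k + 1) * t k * (x : ℚ) ^ k -
      ∑ k ∈ Finset.range p, (g x k : ℚ) * s k)
    (sub_mem (sum_mem fun k hk => mul_mem (mul_mem
      (natCast_div_two_mul_add_one_mem_padicIntegral (Finset.mem_range.1 hk)) (ht k))
      (pow_mem (intCast_mem _ x) k))
      (sum_mem fun k _ => mul_mem (intCast_mem _ _) (hs k))) ?_
  rw [hL, hR] at key
  linear_combination key
end

section
/- Let p > 3 be a prime. Then ∑_{k=0}^{p-1} g_k(−1) ≡ (−1/p) + p²·(∑_{k=0}^{p-1} g_k(−1)·H_k^{(2)} − E_{p-3}) (mod p³), where (−1/p) is the Legendre symbol. -/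
open Finset

/-- The product `∏_{j=1}^k (1 - p²/j²)`. -/
def oneSubSqProd (p k : ℕ) : ℚ := ∏ j ∈ range k, (1 - (p : ℚ) ^ 2 / ((j : ℚ) + 1) ^ 2)

theorem alternating_sum_choose_mul_choose (N A B : ℕ) :
    ∑ m ∈ range (N + 1), (-1 : ℚ) ^ m * N.choose m * (A + m).choose (B + N)
      = (-1) ^ N * A.choose B := by
  have h := fwdDiff_iter_eq_sum_shift (1 : ℕ) (fun x : ℕ ↦ (x.choose (N + B) : ℤ)) N A
  rw [fwdDiff_iter_choose] at h
  have h' := congrArg (fun z : ℤ ↦ (-1 : ℚ) ^ N * (z : ℚ)) h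
  simp only [smul_eq_mul, mul_one] at h'
  push_cast at h'
  rw [h', mul_sum]
  refine sum_congr rfl fun m hm ↦ ?_
  have hm' : m ≤ N := Nat.lt_succ_iff.mp (mem_range.mp hm)
  obtain ⟨d, rfl⟩ := Nat.exists_eq_add_of_le hm'
  have hd : ((-1 : ℚ) ^ d) * (-1) ^ d = 1 := by rw [← mul_pow]; simp
  rw [Nat.add_sub_cancel_left, pow_add, Nat.add_comm B]
  linear_combination (-((-1 : ℚ) ^ m * ((m + d).choose m) * (A + m).choose (m + d + B))) * hd

theorem oneSubSqProd_eq_choose {p k : ℕ} (hk : k < p) :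
    oneSubSqProd p k = (-1) ^ k * (p - 1).choose k * (p + k).choose k := by
  induction k with
  | zero => simp [oneSubSqProd]
  | succ k ih =>
    rw [oneSubSqProd, prod_range_succ, ← oneSubSqProd, ih (by omega)]
    have hk1 : ((k : ℚ) + 1) ≠ 0 := by positivity
    have h1 : ((p - 1).choose (k + 1) : ℚ) * (k + 1) = (p - 1).choose k * (p - 1 - k) := by
      have := congrArg (Nat.cast : ℕ → ℚ) (Nat.choose_succ_right_eq (p - 1) k)
      rw [Nat.cast_mul, Nat.cast_mul, Nat.cast_sub (by omega), Nat.cast_sub (by omega)] at this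
      exact_mod_cast this
    have h2 : ((p + (k + 1)).choose (k + 1) : ℚ) * (k + 1) = (p + k).choose k * (p + k + 1) := by
      have := congrArg (Nat.cast : ℕ → ℚ) (Nat.add_one_mul_choose_eq (p + k) k)
      push_cast at this
      rw [← Nat.add_assoc]
      linear_combination -this
    rw [eq_div_of_mul_eq hk1 h1, eq_div_of_mul_eq hk1 h2]
    field_simp
    ring

theorem choose_mul_centralBinom_eq {p k : ℕ} (hk : k < p) :
    ((p + k).choose (2 * k + 1) : ℚ) * (2 * k).choose k
      = p / (2 * k + 1) * ((-1) ^ k * oneSubSqProd p k) := by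
  obtain ⟨d, rfl⟩ : ∃ d, p = k + d + 1 := ⟨p - k - 1, by omega⟩
  have hs : ((-1 : ℚ) ^ k) * (-1) ^ k = 1 := by rw [← mul_pow]; simp
  rw [oneSubSqProd_eq_choose hk]
  have e1 : (k + d + 1 + k).choose (2 * k + 1)
      = (d + (2 * k + 1)).choose (2 * k + 1) := by congr 1; omega
  have e2 : (2 * k).choose k = (k + k).choose k := by rw [two_mul]
  have e3 : (k + d + 1 - 1).choose k = (d + k).choose k := by congr 1; omega
  rw [e1, e2, e3]
  have q1 := congrArg (Nat.cast : ℕ → ℚ) (Nat.add_choose_mul_factorial_mul_factorial d (2 * k + 1))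
  have q2 := congrArg (Nat.cast : ℕ → ℚ) (Nat.add_choose_mul_factorial_mul_factorial k k)
  have q3 := congrArg (Nat.cast : ℕ → ℚ) (Nat.add_choose_mul_factorial_mul_factorial d k)
  have q4 := congrArg (Nat.cast : ℕ → ℚ)
    (Nat.add_choose_mul_factorial_mul_factorial (k + d + 1) k)
  have e5 : d + (2 * k + 1) = k + d + 1 + k := by omega
  have e6 : (2 * k + 1).factorial = (2 * k + 1) * (k + k).factorial := by
    rw [Nat.factorial_succ, two_mul]
  have e7 : (k + d + 1).factorial = (k + d + 1) * (d + k).factorial := by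
    rw [Nat.factorial_succ, Nat.add_comm d]
  rw [e6] at q1
  rw [e7] at q4
  have hf : ∀ n : ℕ, (n.factorial : ℚ) ≠ 0 := fun n ↦ by positivity
  push_cast at q1 q2 q3 q4
  have h2k : (2 * (k : ℚ) + 1) ≠ 0 := by positivity
  have hp0 : ((k : ℚ) + d + 1) ≠ 0 := by positivity
  have r1 : ((d + (2 * k + 1)).choose (2 * k + 1) : ℚ)
      = (k + d + 1 + k).factorial / (d.factorial * ((2 * k + 1) * (k + k).factorial)) := by
    rw [eq_div_iff (by have := hf d; have := hf (k + k); positivity), ← e5, ← q1]; ring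
  have r2 : ((k + k).choose k : ℚ) = (k + k).factorial / (k.factorial * k.factorial) := by
    rw [eq_div_iff (by positivity), ← q2]; ring
  have r3 : ((d + k).choose k : ℚ) = (d + k).factorial / (d.factorial * k.factorial) := by
    rw [eq_div_iff (by positivity), ← q3]; ring
  have r4 : ((k + d + 1 + k).choose k : ℚ)
      = (k + d + 1 + k).factorial / ((k + d + 1) * (d + k).factorial * k.factorial) := by
    rw [eq_div_iff (by positivity), ← q4]; ring
  rw [r1, r2, r3, r4]
  have := hf d; have := hf k; have := hf (k + k); have := hf (d + k)
  push_cast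
  field_simp
  linear_combination -hs

theorem oneSubSqProd_mul_choose_sq {p k m : ℕ} (hkm : k + m < p) :
    oneSubSqProd p (k + m) * ((k + m).choose k : ℚ) ^ 2
      = oneSubSqProd p k * ((-1) ^ m * (p - 1 - k).choose m * (p + k + m).choose (p + k)) := by
  rw [oneSubSqProd_eq_choose hkm, oneSubSqProd_eq_choose (by omega)]
  have h1 : (p - 1).choose (k + m) * (k + m).choose k
      = (p - 1).choose k * (p - 1 - k).choose m := by
    rw [Nat.choose_mul (by omega), Nat.add_sub_cancel_left]
  have h2 : (p + (k + m)).choose (k + m) * (k + m).choose k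
      = (p + k).choose k * (p + k + m).choose (p + k) := by
    have := Nat.choose_mul (n := p + k + m) (k := p + k) (s := k) (by omega)
    rw [Nat.mul_comm ((p + k).choose k), this, ← Nat.add_assoc p k m,
      Nat.choose_mul (by omega), Nat.add_sub_cancel_left, Nat.add_sub_cancel,
      ← Nat.choose_symm_of_eq_add (n := p + k + m - k) (a := p) (b := m) (by omega)]
  have h1' := congrArg (Nat.cast : ℕ → ℚ) h1
  have h2' := congrArg (Nat.cast : ℕ → ℚ) h2
  push_cast at h1' h2'
  rw [pow_add]
  linear_combination (-1 : ℚ) ^ k * (-1) ^ m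
      * ((p + (k + m)).choose (k + m) * (k + m).choose k) * h1'
    + (-1 : ℚ) ^ k * (-1) ^ m * ((p - 1).choose k * (p - 1 - k).choose m) * h2'

theorem sum_oneSubSqProd_mul_choose_sq {p k : ℕ} (hp : Odd p) (hk : k < p) :
    ∑ n ∈ Ico k p, oneSubSqProd p n * (n.choose k : ℚ) ^ 2
      = (-1) ^ k * oneSubSqProd p k * (p + k).choose (2 * k + 1) := by
  rw [sum_Ico_eq_sum_range]
  have hN : p - k = p - 1 - k + 1 := by omega
  rw [sum_congr rfl fun m hm ↦ oneSubSqProd_mul_choose_sq (p := p) (k := k) (m := m)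
    (by have := mem_range.mp hm; omega), ← mul_sum, hN]
  have hB : p + k = 2 * k + 1 + (p - 1 - k) := by omega
  have h := alternating_sum_choose_mul_choose (p - 1 - k) (p + k) (2 * k + 1)
  rw [← hB] at h
  rw [h]
  have hsgn : (-1 : ℚ) ^ (p - 1 - k) = (-1) ^ k := by
    obtain ⟨q, rfl⟩ := hp
    have : 2 * q + 1 - 1 - k + k = 2 * q := by omega
    have h1 : (-1 : ℚ) ^ (2 * q + 1 - 1 - k) * (-1) ^ k = 1 := by
      rw [← pow_add, this, pow_mul]; simp
    have hs : ((-1 : ℚ) ^ k) * (-1) ^ k = 1 := by rw [← mul_pow]; simp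
    linear_combination (-1 : ℚ) ^ k * h1 - (-1 : ℚ) ^ (2 * q + 1 - 1 - k) * hs
  rw [hsgn]
  ring

theorem sum_g_mul_oneSubSqProd {p : ℕ} (hp : Odd p) (x : ℤ) :
    ∑ n ∈ range p, (g x n : ℚ) * oneSubSqProd p n
      = ∑ k ∈ range p, (p : ℚ) / (2 * k + 1) * oneSubSqProd p k ^ 2 * (x : ℚ) ^ k := by
  have h1 : ∀ n ∈ range p, (g x n : ℚ) * oneSubSqProd p n
      = ∑ k ∈ range (n + 1),
        oneSubSqProd p n * (n.choose k : ℚ) ^ 2 * ((2 * k).choose k * (x : ℚ) ^ k) := by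
    intro n _
    rw [g]
    push_cast
    rw [sum_mul]
    exact sum_congr rfl fun k _ ↦ by ring
  rw [sum_congr rfl h1, sum_comm' (t' := range p) (s' := fun k ↦ Ico k p)
    (by intro n k; simp only [mem_range, mem_Ico]; omega)]
  refine sum_congr rfl fun k hk ↦ ?_
  have hk' := mem_range.mp hk
  have hs : ((-1 : ℚ) ^ k) * (-1) ^ k = 1 := by rw [← mul_pow]; simp
  rw [← sum_mul, sum_oneSubSqProd_mul_choose_sq hp hk']
  linear_combination (-1 : ℚ) ^ k * oneSubSqProd p k * (x : ℚ) ^ k * choose_mul_centralBinom_eq hk'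
    + p / (2 * k + 1) * oneSubSqProd p k ^ 2 * (x : ℚ) ^ k * hs

/-- The polynomial `∑_j C(2m, 2j) E_{2j} x^{2m-2j}`, which is the rescaled Euler polynomial
`2^{2m} E_{2m}((x + 1) / 2)` when `E` is the sequence of Euler numbers. -/
def eulerPolyAux (E : ℕ → ℚ) (m : ℕ) (x : ℚ) : ℚ :=
  ∑ j ∈ range (m + 1), ((2 * m).choose (2 * j) : ℚ) * E (2 * j) * x ^ (2 * (m - j))

theorem sum_range_two_mul_add_one {M : Type*} [AddCommMonoid M] (f : ℕ → M) (n : ℕ) :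
    ∑ i ∈ range (2 * n + 1), f i
      = ∑ i ∈ range (n + 1), f (2 * i) + ∑ i ∈ range n, f (2 * i + 1) := by
  induction n with
  | zero => simp
  | succ n ih =>
    rw [show 2 * (n + 1) + 1 = 2 * n + 1 + 1 + 1 by ring, sum_range_succ, sum_range_succ, ih,
      sum_range_succ _ (n + 1), sum_range_succ (fun i ↦ f (2 * i + 1)) n]
    rw [show 2 * (n + 1) = 2 * n + 1 + 1 by ring]
    abel

theorem add_one_pow_add_sub_one_pow (n : ℕ) (x : ℚ) :
    (x + 1) ^ (2 * n) + (x - 1) ^ (2 * n)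
      = 2 * ∑ i ∈ range (n + 1), ((2 * n).choose (2 * i) : ℚ) * x ^ (2 * (n - i)) := by
  rw [add_comm x 1, sub_eq_add_neg, add_comm x (-1), add_pow, add_pow,
    sum_range_two_mul_add_one, sum_range_two_mul_add_one]
  have h1 : ∀ i : ℕ, ((-1 : ℚ)) ^ (2 * i) = 1 := fun i ↦ by rw [pow_mul]; simp
  have h2 : ∀ i : ℕ, ((-1 : ℚ)) ^ (2 * i + 1) = -1 := fun i ↦ by rw [pow_succ, h1]; simp
  simp only [h1, h2, one_pow, one_mul, neg_mul, sum_neg_distrib, Nat.mul_sub]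
  simp only [mul_comm (_ ^ _ : ℚ)]
  ring

theorem eulerPolyAux_add_one_add_sub_one {E : ℕ → ℚ} (hE0 : E 0 = 1)
    (hErec : ∀ n, 1 ≤ n →
      ∑ k ∈ range (n + 1), ((2 * n).choose (2 * k) : ℚ) * E (2 * k) = 0) (m : ℕ) (x : ℚ) :
    eulerPolyAux E m (x + 1) + eulerPolyAux E m (x - 1) = 2 * x ^ (2 * m) := by
  have h1 : ∀ j ∈ range (m + 1),
      ((2 * m).choose (2 * j) : ℚ) * E (2 * j) * (x + 1) ^ (2 * (m - j))
        + ((2 * m).choose (2 * j) : ℚ) * E (2 * j) * (x - 1) ^ (2 * (m - j))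
      = ∑ s ∈ Ico j (m + 1), 2 * ((2 * m).choose (2 * s) * x ^ (2 * (m - s))) *
          ((2 * s).choose (2 * j) * E (2 * j)) := by
    intro j hj
    have hj' := mem_range.mp hj
    rw [← mul_add, add_one_pow_add_sub_one_pow, sum_Ico_eq_sum_range,
      show m + 1 - j = m - j + 1 by omega, ← mul_assoc, mul_sum]
    refine sum_congr rfl fun i hi ↦ ?_
    have hi' := mem_range.mp hi
    have hc := congrArg (Nat.cast : ℕ → ℚ)
      (Nat.choose_mul (n := 2 * m) (k := 2 * (j + i)) (s := 2 * j) (by omega))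
    rw [show 2 * m - 2 * j = 2 * (m - j) by omega,
      show 2 * (j + i) - 2 * j = 2 * i by omega] at hc
    push_cast at hc
    rw [show m - (j + i) = m - j - i by omega]
    linear_combination -2 * x ^ (2 * (m - j - i)) * E (2 * j) * hc
  rw [eulerPolyAux, eulerPolyAux, ← sum_add_distrib, sum_congr rfl h1,
    sum_comm' (t' := range (m + 1)) (s' := fun s ↦ range (s + 1))
    (by intro n k; simp only [mem_range, mem_Ico]; omega)]
  simp only [← mul_sum]
  rw [sum_eq_single_of_mem 0 (by simp)]
  · simp [hE0]
  · intro s _ hs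
    rw [hErec s (by omega), mul_zero]

theorem two_mul_sum_alternating_odd_pow {E : ℕ → ℚ} (hE0 : E 0 = 1)
    (hErec : ∀ n, 1 ≤ n →
      ∑ k ∈ range (n + 1), ((2 * n).choose (2 * k) : ℚ) * E (2 * k) = 0) (m N : ℕ) :
    2 * ∑ k ∈ range N, (-1 : ℚ) ^ k * (2 * k + 1) ^ (2 * m)
      = eulerPolyAux E m 0 - (-1) ^ N * eulerPolyAux E m (2 * N) := by
  induction N with
  | zero => simp
  | succ N ih =>
    have h := eulerPolyAux_add_one_add_sub_one hE0 hErec m (2 * N + 1)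
    rw [show (2 * (N : ℚ) + 1 + 1) = 2 * ((N + 1 : ℕ) : ℚ) by push_cast; ring,
      add_sub_cancel_right] at h
    rw [sum_range_succ, mul_add, ih, pow_succ]
    linear_combination -(-1 : ℚ) ^ N * h

theorem eulerPolyAux_zero (E : ℕ → ℚ) (m : ℕ) : eulerPolyAux E m 0 = E (2 * m) := by
  rw [eulerPolyAux, sum_range_succ, sum_eq_zero]
  · simp
  · intro j hj
    have := mem_range.mp hj
    rw [zero_pow (by omega), mul_zero]

/-- The subring of `ℚ` consisting of the `p`-integral rational numbers. -/
def pIntegral (p : ℕ) [Fact p.Prime] : Subring ℚ where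
  carrier := {x | padicNorm p x ≤ 1}
  mul_mem' {a b} ha hb := by
    simp only [Set.mem_ofPred_eq, padicNorm.mul] at *
    exact mul_le_one₀ ha (padicNorm.nonneg _) hb
  one_mem' := by simp
  add_mem' {a b} ha hb := padicNorm.nonarchimedean.trans (max_le ha hb)
  zero_mem' := by simp
  neg_mem' {a} ha := by simpa using ha

theorem ratCongr_iff {p : ℕ} [hp : Fact p.Prime] {m : ℕ} {a b : ℚ} :
    ratCongr p m a b ↔ ∃ r ∈ pIntegral p, a - b = (p : ℚ) ^ m * r := by
  have hp0 : (p : ℚ) ≠ 0 := by exact_mod_cast hp.out.ne_zero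
  have hp1 : (1 : ℚ) < p := by exact_mod_cast hp.out.one_lt
  constructor
  · rintro (rfl | h)
    · exact ⟨0, zero_mem _, by simp⟩
    · refine ⟨(a - b) / p ^ m, ?_, by field_simp⟩
      change padicNorm p _ ≤ 1
      by_cases hab : a - b = 0
      · simp [hab]
      · rw [padicNorm.eq_zpow_of_nonzero (div_ne_zero hab (pow_ne_zero _ hp0)),
          padicValRat.div hab (pow_ne_zero _ hp0), padicValRat.pow,
          padicValRat.self hp.out.one_lt]
        exact zpow_le_one_of_nonpos₀ hp1.le (by omega)
  · rintro ⟨r, hr, h⟩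
    by_cases hr0 : r = 0
    · left
      rw [hr0, mul_zero] at h
      exact sub_eq_zero.mp h
    · right
      change padicNorm p r ≤ 1 at hr
      rw [padicNorm.eq_zpow_of_nonzero hr0, zpow_le_one_iff_right₀ hp1] at hr
      rw [h, padicValRat.mul (pow_ne_zero _ hp0) hr0, padicValRat.pow,
        padicValRat.self hp.out.one_lt]
      omega

theorem ratCongr.refl {p m : ℕ} (a : ℚ) : ratCongr p m a a := Or.inl rfl

theorem not_dvd_two_mul_add_one {p h k : ℕ} (hh : p = 2 * h + 1) (hk : k ∈ (range p).erase h) :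
    ¬ p ∣ 2 * k + 1 := by
  rw [mem_erase, mem_range] at hk
  rintro ⟨c, hc⟩
  have h2 : c < 2 := by
    by_contra! h2
    have := Nat.mul_le_mul_left p h2
    omega
  interval_cases c <;> omega

section

variable {p : ℕ} [hp : Fact p.Prime] {m : ℕ} {a b c d : ℚ}

theorem ratCongr.symm (h : ratCongr p m a b) : ratCongr p m b a := by
  rw [ratCongr_iff] at *
  obtain ⟨r, hr, h⟩ := h
  exact ⟨-r, neg_mem hr, by linear_combination -h⟩

theorem ratCongr.trans (h : ratCongr p m a b) (h' : ratCongr p m b c) : ratCongr p m a c := by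
  rw [ratCongr_iff] at *
  obtain ⟨r, hr, h⟩ := h
  obtain ⟨s, hs, h'⟩ := h'
  exact ⟨r + s, add_mem hr hs, by linear_combination h + h'⟩

theorem ratCongr.add (h : ratCongr p m a b) (h' : ratCongr p m c d) :
    ratCongr p m (a + c) (b + d) := by
  rw [ratCongr_iff] at *
  obtain ⟨r, hr, h⟩ := h
  obtain ⟨s, hs, h'⟩ := h'
  exact ⟨r + s, add_mem hr hs, by linear_combination h + h'⟩

theorem ratCongr.const_mul (hc : c ∈ pIntegral p) (h : ratCongr p m a b) :
    ratCongr p m (c * a) (c * b) := by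
  rw [ratCongr_iff] at *
  obtain ⟨r, hr, h⟩ := h
  exact ⟨c * r, mul_mem hc hr, by linear_combination c * h⟩

theorem ratCongr.prime_pow_mul (n : ℕ) (h : ratCongr p m a b) :
    ratCongr p (n + m) ((p : ℚ) ^ n * a) ((p : ℚ) ^ n * b) := by
  rw [ratCongr_iff] at *
  obtain ⟨r, hr, h⟩ := h
  exact ⟨r, hr, by rw [pow_add]; linear_combination (p : ℚ) ^ n * h⟩

theorem ratCongr.sum {ι : Type*} {s : Finset ι} {f g : ι → ℚ}
    (h : ∀ i ∈ s, ratCongr p m (f i) (g i)) : ratCongr p m (∑ i ∈ s, f i) (∑ i ∈ s, g i) := by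
  classical
  induction s using Finset.induction_on with
  | empty => exact .refl _
  | insert i s hi ih =>
    rw [sum_insert hi, sum_insert hi]
    exact (h i (mem_insert_self _ _)).add (ih fun j hj ↦ h j (mem_insert_of_mem hj))

theorem ratCongr.of_two_mul (hp2 : p ≠ 2) (h : ratCongr p m (2 * a) (2 * b)) :
    ratCongr p m a b := by
  have h2 : (2 : ℚ)⁻¹ ∈ pIntegral p := by
    change padicNorm p _ ≤ 1
    have h : padicNorm p ((2 : ℕ) : ℚ) = 1 := by
      rw [padicNorm.nat_eq_one_iff]
      exact fun h ↦ hp2 ((Nat.prime_dvd_prime_iff_eq hp.out Nat.prime_two).mp h)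
    have := padicNorm.div (p := p) 1 ((2 : ℕ) : ℚ)
    rw [h] at this
    simp at this
    simp [this]
  have := h.const_mul h2
  rwa [inv_mul_cancel_left₀ two_ne_zero, inv_mul_cancel_left₀ two_ne_zero] at this

theorem inv_natCast_mem_pIntegral {n : ℕ} (hn : ¬ p ∣ n) : (n : ℚ)⁻¹ ∈ pIntegral p := by
  change padicNorm p _ ≤ 1
  have h := padicNorm.div (p := p) 1 (n : ℚ)
  rw [padicNorm.nat_eq_one_iff n |>.mpr hn, one_div] at h
  simp [h]

theorem ratCongr_inv_sq_pow (hp3 : 3 < p) {n : ℕ} (hn : ¬ p ∣ n) :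
    ratCongr p 1 (((n : ℚ) ^ 2)⁻¹) ((n : ℚ) ^ (p - 3)) := by
  rw [ratCongr_iff]
  have hn0 : (n : ℚ) ≠ 0 := by
    have : n ≠ 0 := fun h ↦ hn (h ▸ dvd_zero p)
    exact_mod_cast this
  have hdvd : (p : ℤ) ∣ (n : ℤ) ^ (p - 1) - 1 := by
    rw [← ZMod.intCast_zmod_eq_zero_iff_dvd]
    push_cast
    rw [ZMod.pow_card_sub_one_eq_one, sub_self]
    rwa [Ne, ZMod.natCast_eq_zero_iff]
  obtain ⟨c, hc⟩ := hdvd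
  have hc' := congrArg (Int.cast : ℤ → ℚ) hc
  push_cast at hc'
  rw [show p - 1 = p - 3 + 2 by omega, pow_add] at hc'
  refine ⟨-c * ((n : ℚ)⁻¹) ^ 2,
    mul_mem (neg_mem (intCast_mem _ c)) (pow_mem (inv_natCast_mem_pIntegral hn) 2), ?_⟩
  field_simp
  linear_combination -hc'

theorem dvd_sum_range_pow {i : ℕ} (hi : i < p - 1) : p ∣ ∑ j ∈ range p, j ^ i := by
  rw [← ZMod.natCast_eq_zero_iff]
  push_cast
  have h := FiniteField.sum_pow_lt_card_sub_one (ZMod p) i (by rwa [ZMod.card])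
  rw [← h]
  refine sum_bij' (fun j _ ↦ (j : ZMod p)) (fun x _ ↦ x.val) (by simp)
    (fun x _ ↦ mem_range.mpr (ZMod.val_lt x)) ?_ (by simp) (by simp)
  intro j hj
  exact ZMod.val_cast_of_lt (mem_range.mp hj)

theorem H2_mem_pIntegral {k : ℕ} (hk : k < p) : H2 k ∈ pIntegral p := by
  refine sum_mem fun j hj ↦ ?_
  have hj' := mem_range.mp hj
  have := pow_mem (inv_natCast_mem_pIntegral (p := p) (n := j + 1)
    (Nat.not_dvd_of_pos_of_lt (by omega) (by omega))) 2
  rw [one_div, ← inv_pow]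
  exact_mod_cast this

theorem ratCongr_H2_sub_one (hp3 : 3 < p) : ratCongr p 1 (H2 (p - 1)) 0 := by
  have h1 : ratCongr p 1 (H2 (p - 1)) (∑ j ∈ range (p - 1), ((j + 1 : ℕ) : ℚ) ^ (p - 3)) := by
    refine ratCongr.sum fun j hj ↦ ?_
    have hj' := mem_range.mp hj
    have := ratCongr_inv_sq_pow hp3 (n := j + 1)
      (Nat.not_dvd_of_pos_of_lt (by omega) (by omega))
    rw [one_div]
    exact_mod_cast this
  refine h1.trans ?_
  obtain ⟨c, hc⟩ := dvd_sum_range_pow (p := p) (i := p - 3) (by omega)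
  obtain ⟨q, hq⟩ : ∃ q, p = q + 1 := ⟨p - 1, by omega⟩
  rw [ratCongr_iff]
  refine ⟨c, natCast_mem _ c, ?_⟩
  have h2 : ∑ j ∈ range p, j ^ (p - 3) = ∑ j ∈ range (p - 1), (j + 1) ^ (p - 3) := by
    conv_lhs => rw [show range p = range (p - 1 + 1) by rw [Nat.sub_add_cancel (by omega)]]
    rw [sum_range_succ', zero_pow (by omega), add_zero]
  rw [h2] at hc
  rw [sub_zero, pow_one]
  exact_mod_cast hc

theorem ratCongr_H2_half {h : ℕ} (hp3 : 3 < p) (hh : p = 2 * h + 1) :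
    ratCongr p 1 (H2 h) 0 := by
  have h1 : H2 (p - 1) = H2 h + ∑ j ∈ range h, (((p : ℚ) - (j + 1)) ^ 2)⁻¹ := by
    rw [H2, show p - 1 = h + h by omega, sum_range_add, ← H2]
    congr 1
    rw [← sum_range_reflect]
    refine sum_congr rfl fun j hj ↦ ?_
    have hj' := mem_range.mp hj
    rw [hh, one_div, Nat.sub_sub, Nat.cast_add, Nat.cast_sub (by omega)]
    push_cast
    ring
  have h2 : ratCongr p 1 (∑ j ∈ range h, (((p : ℚ) - (j + 1)) ^ 2)⁻¹) (H2 h) := by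
    refine ratCongr.sum fun j hj ↦ ?_
    have hj' := mem_range.mp hj
    have i1 := inv_natCast_mem_pIntegral (p := p) (n := j + 1)
      (Nat.not_dvd_of_pos_of_lt (by omega) (by omega))
    have i2 := inv_natCast_mem_pIntegral (p := p) (n := p - (j + 1))
      (Nat.not_dvd_of_pos_of_lt (by omega) (by omega))
    have hne : (p : ℚ) - (j + 1) ≠ 0 := by
      have : ((p - (j + 1) : ℕ) : ℚ) ≠ 0 := by
        exact_mod_cast (by omega : p - (j + 1) ≠ 0)
      rw [Nat.cast_sub (by omega)] at this
      exact_mod_cast this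
    have hj0 : (j : ℚ) + 1 ≠ 0 := by positivity
    rw [Nat.cast_sub (by omega)] at i2
    push_cast at i1 i2
    rw [ratCongr_iff]
    refine ⟨(2 * (j + 1) - p) * (((j : ℚ) + 1)⁻¹ ^ 2 * ((p : ℚ) - (j + 1))⁻¹ ^ 2),
      mul_mem (sub_mem (mul_mem (ofNat_mem _ 2) (add_mem (natCast_mem _ j) (one_mem _)))
        (natCast_mem _ p)) (mul_mem (pow_mem i1 2) (pow_mem i2 2)), ?_⟩
    field_simp
    ring
  have h3 : ratCongr p 1 (2 * H2 h) (2 * 0) := by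
    have := ((ratCongr.refl (H2 h)).add h2).symm
    rw [← h1] at this
    rw [two_mul, mul_zero]
    exact this.trans (ratCongr_H2_sub_one hp3)
  exact h3.of_two_mul (by omega)

theorem ratCongr_oneSubSqProd {k : ℕ} (hk : k < p) :
    ratCongr p 4 (oneSubSqProd p k) (1 - (p : ℚ) ^ 2 * H2 k) := by
  induction k with
  | zero => simpa [oneSubSqProd, H2] using ratCongr.refl 1
  | succ k ih =>
    have ih' := ih (by omega)
    have hH := H2_mem_pIntegral (p := p) (k := k) (by omega)
    have hu := pow_mem (inv_natCast_mem_pIntegral (p := p) (n := k + 1)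
      (Nat.not_dvd_of_pos_of_lt (by omega) (by omega))) 2
    rw [ratCongr_iff] at ih' ⊢
    obtain ⟨r, hr, h⟩ := ih'
    push_cast at hu
    have e1 : oneSubSqProd p (k + 1)
        = oneSubSqProd p k * (1 - (p : ℚ) ^ 2 * ((k : ℚ) + 1)⁻¹ ^ 2) := by
      rw [oneSubSqProd, prod_range_succ, ← oneSubSqProd, inv_pow, ← div_eq_mul_inv]
    have e2 : H2 (k + 1) = H2 k + ((k : ℚ) + 1)⁻¹ ^ 2 := by
      rw [H2, sum_range_succ, ← H2, inv_pow, one_div]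
    rw [e1, e2]
    refine ⟨r + H2 k * ((k : ℚ) + 1)⁻¹ ^ 2 - p ^ 2 * r * ((k : ℚ) + 1)⁻¹ ^ 2,
      sub_mem (add_mem hr (mul_mem hH hu))
        (mul_mem (mul_mem (pow_mem (natCast_mem _ p) 2) hr) hu), ?_⟩
    linear_combination (1 - (p : ℚ) ^ 2 * ((k : ℚ) + 1)⁻¹ ^ 2) * h

theorem ratCongr_oneSubSqProd_sq {k : ℕ} (hk : k < p) :
    ratCongr p 2 (oneSubSqProd p k ^ 2) 1 := by
  have h := ratCongr_oneSubSqProd hk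
  have hH := H2_mem_pIntegral hk
  rw [ratCongr_iff] at h ⊢
  obtain ⟨r, hr, h⟩ := h
  have ha : -H2 k + p ^ 2 * r ∈ pIntegral p :=
    add_mem (neg_mem hH) (mul_mem (pow_mem (natCast_mem _ p) 2) hr)
  refine ⟨(-H2 k + p ^ 2 * r) * (2 + p ^ 2 * (-H2 k + p ^ 2 * r)),
    mul_mem ha (add_mem (ofNat_mem _ 2) (mul_mem (pow_mem (natCast_mem _ p) 2) ha)), ?_⟩
  rw [sub_eq_iff_eq_add.mp h]
  ring

theorem ratCongr_oneSubSqProd_half_sq {h : ℕ} (hp3 : 3 < p) (hh : p = 2 * h + 1) :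
    ratCongr p 3 (oneSubSqProd p h ^ 2) 1 := by
  have h1 := ratCongr_oneSubSqProd (p := p) (k := h) (by omega)
  have h2 := ratCongr_H2_half hp3 hh
  rw [ratCongr_iff] at h1 h2 ⊢
  obtain ⟨r, hr, h1⟩ := h1
  obtain ⟨s, hs, h2⟩ := h2
  have hP := natCast_mem (pIntegral p) p
  have ha : -s + p * r ∈ pIntegral p := add_mem (neg_mem hs) (mul_mem hP hr)
  refine ⟨(-s + p * r) * (2 + p ^ 3 * (-s + p * r)),
    mul_mem ha (add_mem (ofNat_mem _ 2) (mul_mem (pow_mem hP 3) ha)), ?_⟩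
  rw [sub_eq_iff_eq_add.mp h1, sub_eq_iff_eq_add.mp h2]
  ring

theorem ratCongr_sum_g_mul_oneSubSqProd (x : ℤ) :
    ratCongr p 3 (∑ n ∈ range p, (g x n : ℚ) * oneSubSqProd p n)
      ((∑ n ∈ range p, (g x n : ℚ)) - (p : ℚ) ^ 2 * ∑ n ∈ range p, (g x n : ℚ) * H2 n) := by
  rw [mul_sum, ← sum_sub_distrib]
  refine ratCongr.sum fun n hn ↦ ?_
  have h := (ratCongr_oneSubSqProd (mem_range.mp hn)).const_mul (intCast_mem _ (g x n))
  rw [ratCongr_iff] at h ⊢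
  obtain ⟨r, hr, h⟩ := h
  exact ⟨p * r, mul_mem (natCast_mem _ p) hr, by linear_combination h⟩

theorem euler_mem_pIntegral {E : ℕ → ℚ} (hE0 : E 0 = 1)
    (hErec : ∀ n, 1 ≤ n →
      ∑ k ∈ range (n + 1), ((2 * n).choose (2 * k) : ℚ) * E (2 * k) = 0) (n : ℕ) :
    E (2 * n) ∈ pIntegral p := by
  induction n using Nat.strong_induction_on with
  | _ n ih =>
    rcases Nat.eq_zero_or_pos n with rfl | hn
    · simp [hE0, one_mem]
    · have h := hErec n hn
      rw [sum_range_succ, Nat.choose_self, Nat.cast_one, one_mul] at h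
      rw [eq_neg_of_add_eq_zero_right h]
      exact neg_mem (sum_mem fun k hk ↦ mul_mem (natCast_mem _ _) (ih k (mem_range.mp hk)))

theorem ratCongr_eulerPolyAux_two_mul {E : ℕ → ℚ} (hE0 : E 0 = 1)
    (hErec : ∀ n, 1 ≤ n →
      ∑ k ∈ range (n + 1), ((2 * n).choose (2 * k) : ℚ) * E (2 * k) = 0) (m : ℕ) :
    ratCongr p 1 (eulerPolyAux E m (2 * p)) (eulerPolyAux E m 0) := by
  refine ratCongr.sum fun j _ ↦ ratCongr.const_mul (p := p)
    (mul_mem (natCast_mem _ _) (euler_mem_pIntegral hE0 hErec j)) ?_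
  rcases Nat.eq_zero_or_pos (2 * (m - j)) with h0 | h0
  · rw [h0, pow_zero, pow_zero]
    exact .refl _
  · obtain ⟨t, ht⟩ := Nat.exists_eq_add_of_lt h0
    rw [ht, zero_add, ratCongr_iff]
    exact ⟨2 * (2 * p) ^ t, mul_mem (ofNat_mem _ 2)
      (pow_mem (mul_mem (ofNat_mem _ 2) (natCast_mem _ p)) t), by ring⟩

theorem ratCongr_sum_alternating_odd_pow {E : ℕ → ℚ} (hE0 : E 0 = 1)
    (hErec : ∀ n, 1 ≤ n →
      ∑ k ∈ range (n + 1), ((2 * n).choose (2 * k) : ℚ) * E (2 * k) = 0)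
    (hp2 : p ≠ 2) (m : ℕ) :
    ratCongr p 1 (∑ k ∈ range p, (-1 : ℚ) ^ k * (2 * (k : ℚ) + 1) ^ (2 * m)) (E (2 * m)) := by
  refine ratCongr.of_two_mul (p := p) hp2 ?_
  rw [two_mul_sum_alternating_odd_pow hE0 hErec, (hp.out.odd_of_ne_two hp2).neg_one_pow,
    eulerPolyAux_zero, two_mul (E _), neg_one_mul, sub_neg_eq_add]
  refine (ratCongr.refl (p := p) _).add ?_
  rw [← eulerPolyAux_zero E m]
  exact ratCongr_eulerPolyAux_two_mul hE0 hErec m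

theorem ratCongr_sum_alternating_inv_sq {E : ℕ → ℚ} (hE0 : E 0 = 1)
    (hErec : ∀ n, 1 ≤ n →
      ∑ k ∈ range (n + 1), ((2 * n).choose (2 * k) : ℚ) * E (2 * k) = 0)
    {h : ℕ} (hp3 : 3 < p) (hh : p = 2 * h + 1) :
    ratCongr p 1 (∑ k ∈ (range p).erase h, (-1 : ℚ) ^ k * ((2 * (k : ℚ) + 1) ^ 2)⁻¹)
      (E (p - 3)) := by
  have h1 := ratCongr_sum_alternating_odd_pow hE0 hErec (p := p) (by omega) (h - 1)
  rw [show 2 * (h - 1) = p - 3 by omega,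
    ← add_sum_erase _ _ (mem_range.mpr (by omega : h < p))] at h1
  refine ratCongr.trans (p := p) ?_ h1
  rw [← zero_add (∑ k ∈ (range p).erase h, (-1 : ℚ) ^ k * ((2 * (k : ℚ) + 1) ^ 2)⁻¹)]
  refine ratCongr.add (p := p) (ratCongr.symm ?_) (ratCongr.sum fun k hk ↦ ?_)
  · rw [show (2 * (h : ℚ) + 1) = p by rw [hh]; push_cast; rfl,
      show p - 3 = p - 4 + 1 by omega, ratCongr_iff]
    exact ⟨(-1) ^ h * p ^ (p - 4), mul_mem (pow_mem (neg_mem (one_mem _)) h)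
      (pow_mem (natCast_mem _ p) _), by ring⟩
  · refine ratCongr.const_mul (pow_mem (neg_mem (one_mem _)) k) ?_
    exact_mod_cast ratCongr_inv_sq_pow hp3 (not_dvd_two_mul_add_one hh hk)

theorem ratCongr_sum_alternating_inv {E : ℕ → ℚ} (hE0 : E 0 = 1)
    (hErec : ∀ n, 1 ≤ n →
      ∑ k ∈ range (n + 1), ((2 * n).choose (2 * k) : ℚ) * E (2 * k) = 0)
    {h : ℕ} (hp3 : 3 < p) (hh : p = 2 * h + 1) :
    ratCongr p 2 (∑ k ∈ (range p).erase h, (-1 : ℚ) ^ k * (2 * k + 1 : ℚ)⁻¹) (-p * E (p - 3)) := by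
  have hrefl : ∑ k ∈ (range p).erase h, (-1 : ℚ) ^ k * (2 * k + 1 : ℚ)⁻¹
      = ∑ k ∈ (range p).erase h, (-1 : ℚ) ^ k * (2 * p - (2 * k + 1) : ℚ)⁻¹ := by
    have hmem : ∀ k ∈ (range p).erase h, p - 1 - k ∈ (range p).erase h := by
      intro k hk
      rw [mem_erase, mem_range] at *
      omega
    have hinv : ∀ k ∈ (range p).erase h, p - 1 - (p - 1 - k) = k := by
      intro k hk
      rw [mem_erase, mem_range] at *
      omega
    refine sum_bij' (fun k _ ↦ p - 1 - k) (fun k _ ↦ p - 1 - k) hmem hmem hinv hinv ?_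
    intro k hk
    have hk' := mem_range.mp (mem_of_mem_erase hk)
    have hs : (-1 : ℚ) ^ (p - 1 - k) = (-1) ^ k := by
      rw [neg_one_pow_eq_pow_mod_two, neg_one_pow_eq_pow_mod_two (n := k)]
      congr 1
      omega
    rw [hs, Nat.sub_sub, Nat.cast_sub (by omega)]
    push_cast
    congr 2
    ring
  have hterm : ∀ k ∈ (range p).erase h, ratCongr p 2
      ((-1 : ℚ) ^ k * (2 * k + 1 : ℚ)⁻¹ + (-1 : ℚ) ^ k * (2 * p - (2 * k + 1) : ℚ)⁻¹)
      (p * (-2 * ((-1 : ℚ) ^ k * ((2 * (k : ℚ) + 1) ^ 2)⁻¹))) := by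
    intro k hk
    have hk' := mem_range.mp (mem_of_mem_erase hk)
    have hd := not_dvd_two_mul_add_one hh hk
    have i1 := inv_natCast_mem_pIntegral hd
    have i2 := inv_natCast_mem_pIntegral (p := p) (n := 2 * p - (2 * k + 1)) (by
      rw [Nat.dvd_sub_iff_right (by omega) (dvd_mul_left p 2)]
      exact hd)
    have hne : 2 * (p : ℚ) - (2 * k + 1) ≠ 0 := by
      have : ((2 * p - (2 * k + 1) : ℕ) : ℚ) ≠ 0 := by
        exact_mod_cast (by omega : 2 * p - (2 * k + 1) ≠ 0)
      rw [Nat.cast_sub (by omega)] at this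
      exact_mod_cast this
    have hu : 2 * (k : ℚ) + 1 ≠ 0 := by positivity
    rw [Nat.cast_sub (by omega)] at i2
    push_cast at i1 i2
    rw [ratCongr_iff]
    refine ⟨(-1) ^ k * 4 * ((2 * (k : ℚ) + 1)⁻¹ ^ 2 * (2 * (p : ℚ) - (2 * k + 1))⁻¹),
      mul_mem (mul_mem (pow_mem (neg_mem (one_mem _)) k) (ofNat_mem _ 4))
        (mul_mem (pow_mem i1 2) i2), ?_⟩
    field_simp
    ring
  refine ratCongr.of_two_mul (by omega) ?_
  have h1 := ratCongr.sum hterm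
  rw [sum_add_distrib, ← hrefl, ← two_mul, ← mul_sum, ← mul_sum] at h1
  have h2 := ((ratCongr_sum_alternating_inv_sq hE0 hErec hp3 hh).const_mul
    (neg_mem (ofNat_mem _ 2))).prime_pow_mul 1
  rw [pow_one] at h2
  have h3 := h1.trans h2
  rwa [show (p : ℚ) * (-2 * E (p - 3)) = 2 * (-p * E (p - 3)) by ring] at h3

theorem legendreSym_neg_one_eq_neg_one_pow {h : ℕ} (hh : p = 2 * h + 1) :
    legendreSym p (-1) = (-1) ^ h := by
  rw [legendreSym.at_neg_one (p := p) (by omega), ZMod.χ₄_eq_neg_one_pow (by omega)]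
  congr 1
  omega

end

theorem sum_g_neg_one_euler (p : ℕ) [Fact p.Prime] (hp3 : 3 < p)
    (E : ℕ → ℚ) (hE0 : E 0 = 1) (hEodd : ∀ n, Odd n → E n = 0)
    (hErec : ∀ n, 1 ≤ n →
      ∑ k ∈ Finset.range (n + 1), ((2 * n).choose (2 * k) : ℚ) * E (2 * k) = 0) :
    ratCongr p 3
      (∑ k ∈ Finset.range p, (g (-1) k : ℚ))
      ((legendreSym p (-1) : ℚ)
        + (p : ℚ) ^ 2 * ((∑ k ∈ Finset.range p, (g (-1) k : ℚ) * H2 k) - E (p - 3))) := by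
  have hp := Fact.out (p := p.Prime)
  obtain ⟨h, hh⟩ := hp.odd_of_ne_two (by omega)
  have hE := (ratCongr_sum_alternating_inv hE0 hErec hp3 hh).prime_pow_mul 1
  rw [pow_one, mul_sum] at hE
  have hmid := (ratCongr_oneSubSqProd_half_sq hp3 hh).const_mul
    (pow_mem (neg_mem (one_mem (pIntegral p))) h)
  have hrest : ∀ k ∈ (range p).erase h, ratCongr p 3
      ((p : ℚ) / (2 * k + 1) * oneSubSqProd p k ^ 2 * ((-1 : ℤ) : ℚ) ^ k)
      (p * ((-1 : ℚ) ^ k * (2 * k + 1 : ℚ)⁻¹)) := by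
    intro k hk
    have i1 := inv_natCast_mem_pIntegral (not_dvd_two_mul_add_one hh hk)
    push_cast at i1
    have h1 := ((ratCongr_oneSubSqProd_sq (mem_range.mp (mem_of_mem_erase hk))).const_mul
      (mul_mem (pow_mem (neg_mem (one_mem (pIntegral p))) k) i1)).prime_pow_mul 1
    convert h1 using 1
    · push_cast
      ring
    · ring
  have hsum := ratCongr_sum_g_mul_oneSubSqProd (p := p) (-1)
  rw [sum_g_mul_oneSubSqProd ⟨h, hh⟩, ← add_sum_erase _ _ (mem_range.mpr (by omega : h < p))]
    at hsum
  have hcast : (2 * (h : ℚ) + 1) = p := by rw [hh]; push_cast; rfl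
  have hp0 : (p : ℚ) ≠ 0 := by exact_mod_cast hp.ne_zero
  rw [hcast, div_self hp0, one_mul, mul_comm (oneSubSqProd p h ^ 2), Int.cast_neg, Int.cast_one]
    at hsum
  have hfinal := hsum.symm.trans (hmid.add ((ratCongr.sum hrest).trans hE))
  have := hfinal.add (ratCongr.refl ((p : ℚ) ^ 2 * ∑ n ∈ range p, (g (-1) n : ℚ) * H2 n))
  convert this using 1
  · ring
  · rw [legendreSym_neg_one_eq_neg_one_pow hh]
    push_cast
    ring
end

section
/- Let p > 3 be a prime. Then ∑_{k=0}^{p-1} g_k(−3) ≡ (p/3) (mod p²), where (p/3) is the Legendre symbol of p modulo 3. -/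
open Finset

theorem Zsqrtd.one_one_pow_two_mul_add_one (d : ℤ) (h : ℕ) :
    (⟨1, 1⟩ : ℤ√d) ^ (2 * h + 1) =
      ⟨∑ m ∈ range (h + 1), ((2 * h + 1).choose (2 * m) : ℤ) * d ^ m,
        ∑ m ∈ range (h + 1), ((2 * h + 1).choose (2 * m + 1) : ℤ) * d ^ m⟩ := by
  have split : ∀ (f : ℕ → ℤ√d) (n : ℕ),
      ∑ i ∈ range (2 * n), f i = ∑ m ∈ range n, (f (2 * m) + f (2 * m + 1)) := by
    intro f n
    induction n with
    | zero => simp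
    | succ n ih => rw [mul_add, mul_one, sum_range_succ, sum_range_succ, sum_range_succ, ih]; ring
  have hs : ∀ m : ℕ, (Zsqrtd.sqrtd : ℤ√d) ^ (2 * m) = ((d ^ m : ℤ) : ℤ√d) := by
    intro m
    rw [pow_mul, sq, Zsqrtd.dmuld]; push_cast; rfl
  have h1 : (⟨1, 1⟩ : ℤ√d) = Zsqrtd.sqrtd + 1 := by ext <;> simp
  have hd : ∀ a b : ℤ, (⟨a, b⟩ : ℤ√d) = (a : ℤ√d) + Zsqrtd.sqrtd * (b : ℤ√d) := fun a b => Zsqrtd.decompose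
  rw [h1, add_pow, show 2 * h + 1 + 1 = 2 * (h + 1) by ring, split, hd]
  push_cast
  rw [mul_sum, ← sum_add_distrib]
  refine sum_congr rfl fun m _ => ?_
  rw [pow_succ, hs]
  push_cast
  ring

theorem sum_choose_even (h : ℕ) :
    ∑ m ∈ range (h + 1), ((2 * h + 1).choose (2 * m) : ℤ) = 2 ^ (2 * h) := by
  have key : ∀ n : ℕ, (⟨1, 1⟩ : ℤ√1) ^ (n + 1) = ⟨2 ^ n, 2 ^ n⟩ := by
    intro n
    induction n with
    | zero => simp
    | succ n ih => rw [pow_succ, ih, Zsqrtd.ext_iff]; simp; ring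
  simpa using congrArg Zsqrtd.re ((Zsqrtd.one_one_pow_two_mul_add_one 1 h).symm.trans (key _))

theorem legendreSym_three_cases {p : ℕ} (h2 : p % 2 = 1) (h3 : p % 3 ≠ 0) :
    (p % 6 = 1 ∧ legendreSym 3 p = 1) ∨ (p % 6 = 5 ∧ legendreSym 3 p = -1) := by
  have h : p % 6 = 1 ∨ p % 6 = 5 := by omega
  rw [legendreSym.mod]
  rcases h with h | h
  · refine Or.inl ⟨h, ?_⟩
    rw [show (p : ℤ) % (3 : ℕ) = 1 by omega]
    decide
  · refine Or.inr ⟨h, ?_⟩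
    rw [show (p : ℤ) % (3 : ℕ) = 2 by omega]
    decide

theorem Zsqrtd.one_one_pow_eq_legendreSym {p : ℕ} (h2 : p % 2 = 1) (h3 : p % 3 ≠ 0) :
    (⟨1, 1⟩ : ℤ√(-3)) ^ p = ⟨2 ^ (p - 1), legendreSym 3 p * 2 ^ (p - 1)⟩ := by
  have h6 : (⟨1, 1⟩ : ℤ√(-3)) ^ 6 = ((64 : ℤ) : ℤ√(-3)) := by decide
  have h5 : (⟨1, 1⟩ : ℤ√(-3)) ^ 5 = ⟨16, -16⟩ := by decide
  rcases legendreSym_three_cases h2 h3 with ⟨h, e⟩ | ⟨h, e⟩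
  · obtain ⟨q, rfl⟩ : ∃ q, p = 6 * q + 1 := ⟨p / 6, by omega⟩
    rw [e, pow_succ, pow_mul, h6, ← Int.cast_pow]
    have hq : (64 : ℤ) ^ q = 2 ^ (6 * q) := by rw [pow_mul]; norm_num
    rw [hq, Nat.add_sub_cancel]
    generalize (2 : ℤ) ^ (6 * q) = w
    simp
  · obtain ⟨q, rfl⟩ : ∃ q, p = 6 * q + 5 := ⟨p / 6, by omega⟩
    rw [e, pow_add, pow_mul, h6, h5, ← Int.cast_pow]
    have hq : (2 : ℤ) ^ (6 * q + 4) = 64 ^ q * 16 := by rw [pow_add, pow_mul]; norm_num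
    rw [show 6 * q + 5 - 1 = 6 * q + 4 by omega, hq]
    generalize (64 : ℤ) ^ q = w
    simp

/-- `(2k choose k) ∑_{n < N} (n choose k)²`. -/
def centralSum (N k : ℕ) : ℤ :=
  (2 * k).choose k * ∑ n ∈ range N, (n.choose k : ℤ) ^ 2

/-- `(2k + 1) (2k choose k) ∑_{n < N} (n choose k)²`. -/
def weightedSum (N k : ℕ) : ℤ :=
  (2 * k + 1) * centralSum N k

theorem cast_succ_mul_choose_succ (n k : ℕ) :
    ((k : ℤ) + 1) * n.choose (k + 1) = (n - k) * n.choose k := by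
  rcases le_or_gt k n with hk | hk
  · have := Nat.choose_succ_right_eq n k
    zify [hk] at this
    linarith
  · simp [Nat.choose_eq_zero_of_lt hk, Nat.choose_eq_zero_of_lt (hk.trans k.lt_succ_self)]

theorem cast_succ_mul_central_succ (k : ℕ) :
    ((k : ℤ) + 1) * (2 * (k + 1)).choose (k + 1) = 2 * (2 * k + 1) * (2 * k).choose k := by
  have := Nat.succ_mul_centralBinom_succ k
  simp only [Nat.centralBinom] at this
  exact_mod_cast this

theorem succ_mul_weightedSum_succ_sub (N k : ℕ) :
    ((k : ℤ) + 1) * (weightedSum N (k + 1) - weightedSum N k) =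
      (2 * k + 1) * (2 * k).choose k * (2 * N - 3 * k - 3) * (N.choose (k + 1) : ℤ) ^ 2 := by
  induction N with
  | zero => simp [weightedSum, centralSum]
  | succ N ih =>
    have hu := cast_succ_mul_choose_succ N k
    have hc := cast_succ_mul_central_succ k
    simp only [weightedSum, centralSum, sum_range_succ, Nat.choose_succ_succ N k] at ih ⊢
    push_cast at ih ⊢
    set u : ℤ := (N.choose k : ℤ)
    set v : ℤ := (N.choose (k + 1) : ℤ)
    set c : ℤ := ((2 * k).choose k : ℤ)
    linear_combination ih + (2 * k + 3) * v ^ 2 * hc +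
      (2 * k + 1) * c * (4 * v + 2 * u) * hu 

/-- The quotient `(p choose i) / p`, exact for `p` prime and `0 < i < p`. -/
def chooseDiv (p i : ℕ) : ℕ := p.choose i / p

section
variable {p : ℕ} [Fact p.Prime]

theorem cast_choose_pred {i : ℕ} (hi : i < p) : (((p - 1).choose i : ℕ) : ZMod p) = (-1) ^ i := by
  have hp : p.Prime := Fact.out
  induction i with
  | zero => simp
  | succ i ih =>
    have h := Nat.choose_succ_succ (p - 1) i
    rw [Nat.succ_eq_add_one, Nat.sub_add_cancel hp.one_le] at h
    have h0 : ((p.choose (i + 1) : ℕ) : ZMod p) = 0 :=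
      (ZMod.natCast_eq_zero_iff _ _).2 (hp.dvd_choose_self (by omega) hi)
    rw [h, Nat.cast_add, ih (by omega)] at h0
    rw [pow_succ]
    linear_combination h0

theorem choose_eq_mul_choose_div {i : ℕ} (hi : i + 1 < p) :
    (p.choose (i + 1) : ℤ) = p * chooseDiv p (i + 1) := by
  have hp : p.Prime := Fact.out
  exact_mod_cast (Nat.mul_div_cancel' (hp.dvd_choose_self (Nat.succ_ne_zero i) hi)).symm

theorem natCast_ne_zero_of_lt {i : ℕ} (h0 : i ≠ 0) (hi : i < p) : (i : ZMod p) ≠ 0 := by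
  rw [Ne, ZMod.natCast_eq_zero_iff]
  exact fun h => absurd (Nat.le_of_dvd (Nat.pos_of_ne_zero h0) h) (by omega)

theorem cast_choose_div {i : ℕ} (hi : i + 1 < p) :
    (chooseDiv p (i + 1) : ZMod p) = (-1) ^ i / (i + 1) := by
  have hp : p.Prime := Fact.out
  have h := Nat.add_one_mul_choose_eq (p - 1) i
  rw [Nat.sub_add_cancel hp.one_le,
    ← Nat.mul_div_cancel' (hp.dvd_choose_self (Nat.succ_ne_zero i) hi), mul_assoc] at h
  have h := Nat.eq_of_mul_eq_mul_left hp.pos h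
  have h : ((_ : ℕ) : ZMod p) = (_ : ℕ) := congrArg Nat.cast h
  have hne := natCast_ne_zero_of_lt (Nat.succ_ne_zero i) hi
  rw [cast_choose_pred (by omega)] at h
  push_cast at h hne
  rw [chooseDiv, h, mul_div_cancel_right₀ _ hne]

theorem pow_dvd_of_dvd_mul_left {e : ℕ} {n x : ℤ} (hn : (n : ZMod p) ≠ 0)
    (h : (p : ℤ) ^ e ∣ n * x) : (p : ℤ) ^ e ∣ x := by
  have hp : Prime (p : ℤ) := Nat.prime_iff_prime_int.1 Fact.out
  refine IsCoprime.dvd_of_dvd_mul_left (IsCoprime.pow_left ?_) h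
  exact (hp.irreducible.coprime_iff_not_dvd).2 fun hd => hn ((ZMod.intCast_zmod_eq_zero_iff_dvd _ _).2 hd)

theorem two_ne_zero_of_lt (h3 : 3 < p) : (2 : ZMod p) ≠ 0 := by
  exact_mod_cast natCast_ne_zero_of_lt (p := p) (i := 2) (by norm_num) (by omega)

theorem exists_weightedSum_eq (h3 : 3 < p) {k : ℕ} (hk : k < p) :
    ∃ b : ℤ, weightedSum p k = p + p ^ 2 * b ∧
      (b : ZMod p) = -3 / 2 * ∑ m ∈ range k, ((2 * (m + 1)).choose (m + 1) : ZMod p) / (m + 1) := by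
  have hp : p.Prime := Fact.out
  have hp0 : (p : ℤ) ≠ 0 := by exact_mod_cast hp.ne_zero
  have h2 := two_ne_zero_of_lt h3
  induction k with
  | zero => exact ⟨0, by simp [weightedSum, centralSum], by simp⟩
  | succ k ih =>
    obtain ⟨b, hb, hb'⟩ := ih (by omega)
    have hne := natCast_ne_zero_of_lt (Nat.succ_ne_zero k) hk
    have h := succ_mul_weightedSum_succ_sub p k
    have hcK := cast_choose_div hk
    rw [choose_eq_mul_choose_div hk] at h
    generalize chooseDiv p (k + 1) = c at h hcK
    obtain ⟨d, hd⟩ : (p : ℤ) ^ 2 ∣ weightedSum p (k + 1) - weightedSum p k := by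
      refine pow_dvd_of_dvd_mul_left (n := (k : ℤ) + 1) (by push_cast at hne ⊢; exact hne) ?_
      rw [h, mul_pow]
      exact Dvd.dvd.mul_left (dvd_mul_right _ _) _
    refine ⟨b + d, by linear_combination hb + hd, ?_⟩
    have hz : ((k : ℤ) + 1) * d =
        (2 * k + 1) * (2 * k).choose k * (2 * p - 3 * k - 3) * (c : ℤ) ^ 2 := by
      refine mul_left_cancel₀ (pow_ne_zero 2 hp0) ?_
      linear_combination h - ((k : ℤ) + 1) * hd
    have hz := congrArg (Int.cast : ℤ → ZMod p) hz
    have hc := congrArg (Int.cast : ℤ → ZMod p) (cast_succ_mul_central_succ k)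
    push_cast at hz hc hne
    have hs : ((-1 : ZMod p) ^ k) ^ 2 = 1 := by rw [← pow_mul, mul_comm, pow_mul]; simp
    rw [hcK, CharP.cast_eq_zero (ZMod p) p, div_pow, hs] at hz
    rw [sum_range_succ, mul_add, ← hb']
    push_cast
    congr 1
    refine mul_left_cancel₀ hne (hz.trans ?_)
    field_simp
    linear_combination 3 * ((k : ZMod p) + 1) * hc

theorem cast_central_eq {h : ℕ} (hp : p = 2 * h + 1) {k : ℕ} (hk : k ≤ h) :
    ((2 * k).choose k : ZMod p) = (-4) ^ k * h.choose k := by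
  induction k with
  | zero => simp
  | succ k ih =>
    have hne := natCast_ne_zero_of_lt (p := p) (Nat.succ_ne_zero k) (by omega)
    have hc := congrArg (Int.cast : ℤ → ZMod p) (cast_succ_mul_central_succ k)
    have hu := congrArg (Int.cast : ℤ → ZMod p) (cast_succ_mul_choose_succ h k)
    have hh : (2 * h + 1 : ZMod p) = 0 := by
      have := CharP.cast_eq_zero (ZMod p) p
      rw [← this]
      exact_mod_cast congrArg (Nat.cast : ℕ → ZMod p) hp.symm
    push_cast at hc hu hne
    rw [ih (by omega)] at hc
    refine mul_left_cancel₀ hne ?_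
    rw [pow_succ]
    linear_combination hc + 4 * (-4) ^ k * hu + 2 * (-4) ^ k * (h.choose k : ZMod p) * hh

theorem sum_pow_mul_choose_div (x : ZMod p) {n : ℕ} (hn : n < p) :
    ∑ m ∈ range n, x ^ (m + 1) * (n.choose (m + 1) : ZMod p) / (m + 1) =
      ∑ m ∈ range n, ((1 + x) ^ (m + 1) - 1) / (m + 1) := by
  induction n with
  | zero => simp
  | succ n ih =>
    have hne := natCast_ne_zero_of_lt (p := p) (Nat.succ_ne_zero n) hn
    push_cast at hne
    have key : ∑ m ∈ range (n + 1), x ^ (m + 1) * (n.choose m : ZMod p) / (m + 1) =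
        ((1 + x) ^ (n + 1) - 1) / (n + 1) := by
      rw [eq_div_iff hne, add_comm 1 x, add_pow, sum_range_succ' _ (n + 1), sum_mul]
      rw [pow_zero, Nat.choose_zero_right, Nat.cast_one, one_pow, mul_one, mul_one, add_sub_cancel_right]
      simp only [one_pow, mul_one]
      refine sum_congr rfl fun m hm => ?_
      have hm' := natCast_ne_zero_of_lt (p := p) (Nat.succ_ne_zero m) (by rw [mem_range] at hm; omega)
      have h := congrArg (Nat.cast : ℕ → ZMod p) (Nat.add_one_mul_choose_eq n m)
      push_cast at h hm'
      field_simp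
      linear_combination x ^ (m + 1) * h
    rw [sum_range_succ (fun m : ℕ => ((1 + x) ^ (m + 1) - 1) / ((m : ZMod p) + 1)), ← key, ← ih (by omega)]
    have h0 : ∑ m ∈ range n, x ^ (m + 1) * (n.choose (m + 1) : ZMod p) / (m + 1) =
        ∑ m ∈ range (n + 1), x ^ (m + 1) * (n.choose (m + 1) : ZMod p) / (m + 1) := by
      simp [sum_range_succ]
    rw [h0, ← sum_add_distrib]
    refine sum_congr rfl fun m _ => ?_
    rw [Nat.choose_succ_succ]
    push_cast
    ring

theorem sum_even_choose_div {h : ℕ} (hp : p = 2 * h + 1) (x : ℤ) :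
    ∑ m ∈ range (h + 1), (p.choose (2 * m) : ℤ) * x ^ m =
      1 + p * ∑ m ∈ range h, (chooseDiv p (2 * m + 2) : ℤ) * x ^ (m + 1) := by
  rw [sum_range_succ', add_comm, mul_sum]
  congr 1
  · simp
  · refine sum_congr rfl fun m hm => ?_
    rw [mem_range] at hm
    rw [mul_add, mul_one, choose_eq_mul_choose_div (by omega), mul_assoc]

theorem sum_odd_choose_div {h : ℕ} (hp : p = 2 * h + 1) (x : ℤ) :
    ∑ m ∈ range (h + 1), (p.choose (2 * m + 1) : ℤ) * x ^ m =
      x ^ h + p * ∑ m ∈ range h, (chooseDiv p (2 * m + 1) : ℤ) * x ^ m := by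
  rw [sum_range_succ, add_comm, mul_sum]
  congr 1
  · simp [← hp]
  · refine sum_congr rfl fun m hm => ?_
    rw [mem_range] at hm
    rw [choose_eq_mul_choose_div (by omega), mul_assoc]

theorem two_pow_eq_even {h : ℕ} (hp : p = 2 * h + 1) (h3 : p % 3 ≠ 0) :
    1 + (p : ℤ) * ∑ m ∈ range h, (chooseDiv p (2 * m + 2) : ℤ) * (-3) ^ (m + 1) = 2 ^ (p - 1) := by
  rw [← sum_even_choose_div hp]
  have h1 := Zsqrtd.one_one_pow_eq_legendreSym (p := p) (by omega) h3
  have h2 := Zsqrtd.one_one_pow_two_mul_add_one (-3) h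
  rw [← hp] at h2
  exact congrArg Zsqrtd.re (h2.symm.trans h1)

theorem legendreSym_mul_two_pow_eq_odd {h : ℕ} (hp : p = 2 * h + 1) (h3 : p % 3 ≠ 0) :
    (-3) ^ h + (p : ℤ) * ∑ m ∈ range h, (chooseDiv p (2 * m + 1) : ℤ) * (-3) ^ m =
      legendreSym 3 p * 2 ^ (p - 1) := by
  rw [← sum_odd_choose_div hp]
  have h1 := Zsqrtd.one_one_pow_eq_legendreSym (p := p) (by omega) h3
  have h2 := Zsqrtd.one_one_pow_two_mul_add_one (-3) h
  rw [← hp] at h2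
  exact congrArg Zsqrtd.im (h2.symm.trans h1)

theorem sum_central_div_eq_zero {h : ℕ} (hp : p = 2 * h + 1) (h3 : p % 3 ≠ 0) :
    ∑ m ∈ range h, ((2 * (m + 1)).choose (m + 1) : ZMod p) / (m + 1) = 0 := by
  have hp0 : (p : ℤ) ≠ 0 := by omega
  have h1 : ∑ m ∈ range h, ((2 * (m + 1)).choose (m + 1) : ZMod p) / (m + 1) =
      ∑ m ∈ range h, ((1 + -4) ^ (m + 1) - 1 : ZMod p) / (m + 1) := by
    rw [← sum_pow_mul_choose_div _ (by omega)]
    refine sum_congr rfl fun m hm => ?_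
    rw [mem_range] at hm
    rw [cast_central_eq hp (by omega)]
  have h2 : ∑ m ∈ range h, (chooseDiv p (2 * m + 2) : ℤ) * ((-3) ^ (m + 1) - 1 : ℤ) = 0 := by
    have ha := two_pow_eq_even hp h3
    have hb := sum_even_choose_div hp 1
    have hc := sum_choose_even h
    rw [← hp] at hc
    simp only [one_pow, mul_one] at hb
    rw [hc] at hb
    simp only [mul_sub, mul_one, sum_sub_distrib]
    refine (mul_eq_zero.1 (?_ : (p : ℤ) * _ = 0)).resolve_left hp0
    rw [show p - 1 = 2 * h by omega] at ha
    linear_combination ha + hb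
  have h2 := congrArg (Int.cast : ℤ → ZMod p) h2
  push_cast at h2
  rw [h1, ← mul_zero (-2 : ZMod p), ← h2, mul_sum]
  refine sum_congr rfl fun m hm => ?_
  rw [mem_range] at hm
  have hc := cast_choose_div (p := p) (i := 2 * m + 1) (by omega)
  have hne' := natCast_ne_zero_of_lt (p := p) (i := m + 1) (by omega) (by omega)
  have h2' := natCast_ne_zero_of_lt (p := p) (i := 2) (by omega) (by omega)
  rw [hc, Odd.neg_one_pow ⟨m, rfl⟩]
  push_cast at hne' h2' ⊢
  rw [show (2 * (m : ZMod p) + 1 + 1) = 2 * (m + 1) by ring]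
  field_simp
  ring

theorem two_mul_add_one_cast_ne_zero {k : ℕ} (hk : k < p) (hkp : 2 * k + 1 ≠ p) :
    (2 * (k : ZMod p) + 1) ≠ 0 := by
  have : ((2 * k + 1 : ℕ) : ZMod p) ≠ 0 := by
    rw [Ne, ZMod.natCast_eq_zero_iff]
    rintro ⟨t, ht⟩
    obtain rfl | rfl | ht2 : t = 0 ∨ t = 1 ∨ 2 ≤ t := by omega
    · omega
    · omega
    · have := Nat.mul_le_mul_left p ht2
      omega
  exact_mod_cast this

theorem exists_centralSum_eq_mul (h3 : 3 < p) {k : ℕ} (hk : k < p) (hkp : 2 * k + 1 ≠ p) :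
    ∃ a : ℤ, centralSum p k = p * a ∧ (a : ZMod p) = 1 / (2 * k + 1) := by
  have hp0 : (p : ℤ) ≠ 0 := by omega
  have hne := two_mul_add_one_cast_ne_zero hk hkp
  obtain ⟨b, hb, -⟩ := exists_weightedSum_eq h3 hk
  rw [weightedSum] at hb
  obtain ⟨a, ha⟩ : (p : ℤ) ^ 1 ∣ centralSum p k := by
    refine pow_dvd_of_dvd_mul_left (n := 2 * (k : ℤ) + 1) (by push_cast; exact hne) ?_
    rw [hb]
    exact ⟨1 + p * b, by ring⟩
  rw [pow_one] at ha
  refine ⟨a, ha, ?_⟩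
  have hz : (2 * (k : ℤ) + 1) * a = 1 + p * b := by
    refine mul_left_cancel₀ hp0 ?_
    linear_combination hb - (2 * (k : ℤ) + 1) * ha
  have hz := congrArg (Int.cast : ℤ → ZMod p) hz
  push_cast at hz
  rw [CharP.cast_eq_zero (ZMod p) p, zero_mul, add_zero] at hz
  rw [eq_div_iff hne, mul_comm, hz]

theorem exists_centralSum_half_eq {h : ℕ} (hp : p = 2 * h + 1) (h3 : 3 < p) :
    ∃ b : ℤ, centralSum p h = 1 + p ^ 2 * b := by
  have hp0 : (p : ℤ) ≠ 0 := by omega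
  have h3' : p % 3 ≠ 0 := fun h0 => by
    have := (Nat.prime_dvd_prime_iff_eq Nat.prime_three (Fact.out : p.Prime)).1
      (Nat.dvd_of_mod_eq_zero h0)
    omega
  obtain ⟨b, hb, hb0⟩ := exists_weightedSum_eq h3 (show h < p by omega)
  rw [sum_central_div_eq_zero hp h3', mul_zero, ZMod.intCast_zmod_eq_zero_iff_dvd] at hb0
  obtain ⟨c, rfl⟩ := hb0
  refine ⟨c, mul_left_cancel₀ hp0 ?_⟩
  rw [weightedSum, show (2 * (h : ℤ) + 1) = p by rw [hp]; push_cast; rfl] at hb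
  linear_combination hb

end

theorem sum_g_eq_sum_centralSum (x : ℤ) (N : ℕ) :
    ∑ n ∈ range N, g x n = ∑ k ∈ range N, x ^ k * centralSum N k := by
  have h : ∀ n ∈ range N, g x n =
      ∑ k ∈ range N, (n.choose k : ℤ) ^ 2 * ((2 * k).choose k : ℤ) * x ^ k := by
    intro n hn
    rw [mem_range] at hn
    refine sum_subset (range_mono hn) fun k _ hk => ?_
    rw [mem_range, not_lt] at hk
    simp [Nat.choose_eq_zero_of_lt (show n < k from hk)]
  rw [sum_congr rfl h, sum_comm]
  refine sum_congr rfl fun k _ => ?_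
  rw [centralSum, mul_sum, mul_sum]
  exact sum_congr rfl fun n _ => by ring

theorem sum_g_neg_three (p : ℕ) (hp : p.Prime) (hp3 : 3 < p) :
    (p : ℤ) ^ 2 ∣ (∑ k ∈ Finset.range p, g (-3) k) - legendreSym 3 p := by
  have : Fact p.Prime := ⟨hp⟩
  obtain ⟨h, hh⟩ : ∃ h, p = 2 * h + 1 := hp.odd_of_ne_two (by omega)
  have h3 : p % 3 ≠ 0 := fun h0 => by
    have := (Nat.prime_dvd_prime_iff_eq Nat.prime_three hp).1 (Nat.dvd_of_mod_eq_zero h0)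
    omega
  have ha : ∀ k, ∃ a : ℤ, k < p → 2 * k + 1 ≠ p →
      centralSum p k = p * a ∧ (a : ZMod p) = 1 / (2 * k + 1) := by
    intro k
    by_cases hk : k < p ∧ 2 * k + 1 ≠ p
    · obtain ⟨a, h⟩ := exists_centralSum_eq_mul hp3 hk.1 hk.2
      exact ⟨a, fun _ _ => h⟩
    · exact ⟨0, fun h1 h2 => absurd ⟨h1, h2⟩ hk⟩
  choose a ha using ha
  obtain ⟨b, hb⟩ := exists_centralSum_half_eq hh hp3
  have hE := two_pow_eq_even hh h3
  have hO := legendreSym_mul_two_pow_eq_odd hh h3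
  set ε := legendreSym 3 p
  have hlow : ∑ k ∈ range h, (-3) ^ k * centralSum p k = p * ∑ k ∈ range h, (-3) ^ k * a k := by
    rw [mul_sum]
    refine sum_congr rfl fun k hk => ?_
    rw [mem_range] at hk
    rw [(ha k (by omega) (by omega)).1]
    ring
  have hhigh : ∑ m ∈ range h, (-3) ^ (h + (m + 1)) * centralSum p (h + (m + 1)) =
      p * ∑ m ∈ range h, (-3) ^ (h + (m + 1)) * a (h + (m + 1)) := by
    rw [mul_sum]
    refine sum_congr rfl fun k hk => ?_
    rw [mem_range] at hk
    rw [(ha _ (by omega) (by omega)).1]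
    ring
  have hS : ∑ k ∈ range p, g (-3) k = p * ∑ k ∈ range h, (-3) ^ k * a k +
      (p * ∑ m ∈ range h, (-3) ^ (h + (m + 1)) * a (h + (m + 1)) +
        (-3) ^ h * (1 + p ^ 2 * b)) := by
    rw [sum_g_eq_sum_centralSum, ← hlow, ← hhigh, ← hb]
    conv_lhs => rw [hh, show 2 * h + 1 = h + (h + 1) by ring, sum_range_add, sum_range_succ' _ h]
    rw [show h + (h + 1) = p by omega, add_zero]
  have hεp : ((-3 : ZMod p)) ^ h = (ε : ZMod p) := by
    have h1 := congrArg (Int.cast : ℤ → ZMod p) hE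
    have h2 := congrArg (Int.cast : ℤ → ZMod p) hO
    push_cast at h1 h2
    rw [CharP.cast_eq_zero (ZMod p) p, zero_mul, add_zero] at h1 h2
    rw [h2, ← h1, mul_one]
  have hodd : ((∑ k ∈ range h, (-3) ^ k * a k : ℤ) : ZMod p) =
      (∑ m ∈ range h, (chooseDiv p (2 * m + 1) : ℤ) * (-3) ^ m : ℤ) := by
    push_cast
    refine sum_congr rfl fun k hk => ?_
    rw [mem_range] at hk
    rw [(ha k (by omega) (by omega)).2, cast_choose_div (by omega), pow_mul]
    push_cast
    norm_num
    ring
  have heven : ((∑ m ∈ range h, (-3) ^ (h + (m + 1)) * a (h + (m + 1)) : ℤ) : ZMod p) =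
      -(ε * (∑ m ∈ range h, (chooseDiv p (2 * m + 2) : ℤ) * (-3) ^ (m + 1) : ℤ)) := by
    push_cast
    rw [mul_sum, ← sum_neg_distrib]
    refine sum_congr rfl fun m hm => ?_
    rw [mem_range] at hm
    have hz : (2 * (h : ZMod p) + 1) = 0 := by
      rw [← CharP.cast_eq_zero (ZMod p) p]
      exact_mod_cast congrArg (Nat.cast : ℕ → ZMod p) hh.symm
    have hden : 2 * (((h + (m + 1) : ℕ) : ZMod p)) + 1 = ((2 * m + 1 : ℕ) : ZMod p) + 1 := by
      push_cast
      linear_combination hz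
    rw [(ha _ (by omega) (by omega)).2, cast_choose_div (i := 2 * m + 1) (by omega), hden,
      pow_add, hεp, Odd.neg_one_pow ⟨m, rfl⟩]
    ring
  rw [hS]
  have hmod : ((p : ℕ) : ℤ) ∣ ∑ k ∈ range h, (-3) ^ k * a k +
      ∑ m ∈ range h, (-3) ^ (h + (m + 1)) * a (h + (m + 1)) +
      ε * ∑ m ∈ range h, (chooseDiv p (2 * m + 2) : ℤ) * (-3) ^ (m + 1) -
      ∑ m ∈ range h, (chooseDiv p (2 * m + 1) : ℤ) * (-3) ^ m := by
    rw [← ZMod.intCast_zmod_eq_zero_iff_dvd, Int.cast_sub, Int.cast_add, Int.cast_add,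
      Int.cast_mul, hodd, heven]
    ring
  obtain ⟨t, ht⟩ := hmod
  exact ⟨t + (-3) ^ h * b, by linear_combination p * ht + hO - ε * hE⟩
end

section
/- Let p > 5 be a prime. Then ∑_{k=1}^{p-1} g_k(−1)/k² ≡ 0 (mod p). -/
open Finset Nat

namespace ZMod

lemma natCast_ne_zero_of_lt {p k : ℕ} (hk : 0 < k) (hkp : k < p) : (k : ZMod p) ≠ 0 := by
  rw [Ne, ZMod.natCast_eq_zero_iff]
  exact Nat.not_dvd_of_pos_of_lt hk hkp

lemma factorial_ne_zero {p : ℕ} [hp : Fact p.Prime] {k : ℕ} (hk : k < p) :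
    (k ! : ZMod p) ≠ 0 := by
  rw [Ne, ZMod.natCast_eq_zero_iff, hp.out.dvd_factorial]
  omega

lemma natCast_sub_natCast_self {p k : ℕ} (hk : k ≤ p) : ((p - k : ℕ) : ZMod p) = -k := by
  rw [Nat.cast_sub hk, ZMod.natCast_self, zero_sub]

/-- A reflection formula for factorials, generalizing Wilson's lemma. -/
lemma factorial_mul_factorial_sub {p : ℕ} [hp : Fact p.Prime] {a b : ℕ} (hab : a + b + 1 = p) :
    (a ! : ZMod p) * b ! = (-1) ^ (a + 1) := by
  induction a generalizing b with
  | zero =>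
    have h := ZMod.wilsons_lemma p
    rw [show p - 1 = b by omega] at h
    simp [h]
  | succ a ih =>
    have h := ih (b := b + 1) (by omega)
    have hb : ((b + 1 : ℕ) : ZMod p) = -((a + 1 : ℕ) : ZMod p) := by
      rw [← natCast_sub_natCast_self (by omega : a + 1 ≤ p)]
      congr 1
      omega
    rw [Nat.factorial_succ, Nat.cast_mul, hb] at h
    rw [Nat.factorial_succ, Nat.cast_mul, pow_succ, ← h]
    ring

lemma sum_range_natCast {p : ℕ} [NeZero p] {M : Type*} [AddCommMonoid M] (f : ZMod p → M) :
    ∑ m ∈ range p, f m = ∑ x : ZMod p, f x :=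
  Finset.sum_nbij' (fun m => (m : ZMod p)) ZMod.val (by simp)
    (fun x _ => Finset.mem_range.2 x.val_lt)
    (fun m hm => ZMod.val_cast_of_lt (Finset.mem_range.1 hm)) (by simp) (by simp)

lemma sum_inv_sq {p : ℕ} [Fact p.Prime] (hp3 : 3 < p) :
    ∑ k ∈ Icc 1 (p - 1), ((k : ZMod p) ^ 2)⁻¹ = 0 := by
  have h : ∑ x : ZMod p, (x ^ 2)⁻¹ = 0 := by
    have h2 := FiniteField.sum_pow_lt_card_sub_one (ZMod p) 2 (by rw [ZMod.card]; omega)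
    rw [← h2]
    exact Finset.sum_nbij' (·⁻¹) (·⁻¹) (by simp) (by simp) (by simp) (by simp) (by simp)
  rw [← sum_range_natCast (fun x : ZMod p => (x ^ 2)⁻¹), Finset.range_eq_Ico,
    Finset.sum_eq_sum_Ico_succ_bot (by omega)] at h
  rw [← h, ← Finset.Ico_add_one_right_eq_Icc, Nat.sub_add_cancel (by omega)]
  simp

lemma sum_eval_eq_zero {F : Type*} [Field F] [Fintype F] (P : Polynomial F)
    (hP : P.natDegree < Fintype.card F - 1) : ∑ x : F, P.eval x = 0 := by
  simp_rw [Polynomial.eval_eq_sum_range]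
  rw [Finset.sum_comm]
  refine Finset.sum_eq_zero fun i hi => ?_
  rw [← Finset.mul_sum, FiniteField.sum_pow_lt_card_sub_one F i
    (by have := Finset.mem_range.1 hi; omega), mul_zero]

lemma sum_range_choose_sq {p : ℕ} [hp : Fact p.Prime] {j : ℕ} (hj : 2 * j < p - 1) :
    ∑ m ∈ range p, ((m.choose j : ℕ) : ZMod p) ^ 2 = 0 := by
  have hne : (j ! : ZMod p) ^ 2 ≠ 0 := pow_ne_zero _ (factorial_ne_zero (by omega))
  apply (mul_eq_zero_iff_left hne).1
  rw [Finset.mul_sum]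
  have h := sum_eval_eq_zero ((descPochhammer (ZMod p) j) ^ 2) (by
    rw [ZMod.card, Polynomial.natDegree_pow, descPochhammer_natDegree]
    exact hj)
  rw [← h, ← sum_range_natCast]
  refine Finset.sum_congr rfl fun m _ => ?_
  rw [Polynomial.eval_pow, descPochhammer_eval_eq_descFactorial,
    Nat.descFactorial_eq_factorial_mul_choose]
  push_cast
  ring

lemma choose_pred_prime_sq {p : ℕ} [hp : Fact p.Prime] {j : ℕ} (hj : j < p) :
    (((p - 1).choose j : ℕ) : ZMod p) ^ 2 = 1 := by
  have h := congrArg (Nat.cast (R := ZMod p))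
    (Nat.choose_mul_factorial_mul_factorial (show j ≤ p - 1 by omega))
  push_cast at h
  rw [mul_assoc, factorial_mul_factorial_sub (by omega), ZMod.wilsons_lemma] at h
  have h2 : (((p - 1).choose j : ℕ) : ZMod p) ^ 2 * ((-1) ^ (j + 1)) ^ 2 = 1 := by
    rw [← mul_pow, h]
    norm_num
  rwa [← pow_mul, mul_comm (j + 1), pow_mul, neg_one_sq, one_pow, mul_one] at h2

lemma centralBinom_eq_zero {p : ℕ} [hp : Fact p.Prime] {k : ℕ} (hk : k < p) (hpk : p ≤ 2 * k) :
    (((2 * k).choose k : ℕ) : ZMod p) = 0 := by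
  have h := congrArg (Nat.cast (R := ZMod p))
    (Nat.choose_mul_factorial_mul_factorial (show k ≤ 2 * k by omega))
  have h0 : ((2 * k)! : ZMod p) = 0 :=
    (ZMod.natCast_eq_zero_iff _ _).2 ((hp.out.dvd_factorial).2 hpk)
  rw [show 2 * k - k = k by omega] at h
  push_cast at h
  rw [h0] at h
  simpa [factorial_ne_zero hk] using h

lemma centralBinom_eq_div {p : ℕ} [hp : Fact p.Prime] {k : ℕ} (hk : k < p) :
    (((2 * k).choose k : ℕ) : ZMod p) = (2 * k)! / (k ! : ZMod p) ^ 2 := by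
  have h := congrArg (Nat.cast (R := ZMod p))
    (Nat.choose_mul_factorial_mul_factorial (show k ≤ 2 * k by omega))
  rw [show 2 * k - k = k by omega] at h
  push_cast at h
  rw [eq_div_iff (pow_ne_zero _ (factorial_ne_zero hk)), ← h]
  ring

/-- For a fixed `j`, the terms `(k-1)!² / ((k-j)! (k+j)!)` telescope in `k`. -/
lemma sum_factorial_telescope_right {p : ℕ} [hp : Fact p.Prime] {j K : ℕ} (hj : 1 ≤ j)
    (hjK : j ≤ K) (hK : K + j < p) :
    ∑ k ∈ Icc j K, ((k - 1)! : ZMod p) ^ 2 / ((k - j)! * (k + j)!) =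
      (K ! : ZMod p) ^ 2 / ((K - j)! * (K + j)!) / (j : ZMod p) ^ 2 := by
  have hj0 : (j : ZMod p) ≠ 0 := natCast_ne_zero_of_lt hj (by omega)
  induction K, hjK using Nat.le_induction with
  | base =>
    obtain ⟨i, rfl⟩ : ∃ i, j = i + 1 := ⟨j - 1, by omega⟩
    have := factorial_ne_zero hK
    rw [Finset.Icc_self, Finset.sum_singleton, Nat.add_sub_cancel, Nat.factorial_succ i]
    push_cast at hj0 ⊢
    field_simp
  | succ K hjK ih =>
    rw [← Finset.insert_Icc_right_eq_Icc_add_one (by omega), Finset.sum_insert (by simp),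
      ih (by omega)]
    obtain ⟨d, rfl⟩ : ∃ d, K = j + d := ⟨K - j, by omega⟩
    rw [show j + d + 1 - j = d + 1 by omega, show j + d - j = d by omega, Nat.add_sub_cancel,
      show j + d + 1 + j = (j + d + j) + 1 by omega]
    have h1 := factorial_ne_zero (p := p) (k := d) (by omega)
    have h2 := factorial_ne_zero (p := p) (k := j + d + j) (by omega)
    have h3 := natCast_ne_zero_of_lt (p := p) (k := d + 1) (by omega) (by omega)
    have h4 := natCast_ne_zero_of_lt (p := p) (k := j + d + j + 1) (by omega) (by omega)
    rw [Nat.factorial_succ (j + d), Nat.factorial_succ d, Nat.factorial_succ (j + d + j)]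
    push_cast at h3 h4 ⊢
    field_simp
    ring

/-- For a fixed `k`, the terms `(-1)ʲ / ((k-j)! (k+j)!)` telescope in `j`. -/
lemma sum_factorial_telescope_left {p : ℕ} [hp : Fact p.Prime] (hp2 : 2 < p) {k J : ℕ}
    (hk : 1 ≤ k) (hJk : J ≤ k) (hJ : k + J < p) :
    ∑ j ∈ Icc 1 J, (-1 : ZMod p) ^ j / ((k - j)! * (k + j)!) =
      ((-1) ^ J * (k - J) / ((k - J)! * (k + J)!) - k / (k ! : ZMod p) ^ 2) / (2 * k) := by
  have hk0 : (k : ZMod p) ≠ 0 := natCast_ne_zero_of_lt hk (by omega)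
  have h20 : (2 : ZMod p) ≠ 0 := by
    exact_mod_cast natCast_ne_zero_of_lt (p := p) (k := 2) (by omega) hp2
  induction J with
  | zero => simp [sq]
  | succ J ih =>
    rw [← Finset.insert_Icc_right_eq_Icc_add_one (by omega), Finset.sum_insert (by simp),
      ih (by omega) (by omega)]
    obtain ⟨d, rfl⟩ : ∃ d, k = J + 1 + d := ⟨k - (J + 1), by omega⟩
    rw [show J + 1 + d - (J + 1) = d by omega, show J + 1 + d - J = d + 1 by omega,
      show J + 1 + d + (J + 1) = (J + 1 + d + J) + 1 by omega]
    have h0 := factorial_ne_zero (p := p) (k := J + 1 + d) (by omega)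
    have h1 := factorial_ne_zero (p := p) (k := d) (by omega)
    have h2 := factorial_ne_zero (p := p) (k := J + 1 + d + J) (by omega)
    have h3 := natCast_ne_zero_of_lt (p := p) (k := d + 1) (by omega) (by omega)
    have h4 := natCast_ne_zero_of_lt (p := p) (k := J + 1 + d + J + 1) (by omega) (by omega)
    rw [Nat.factorial_succ d, Nat.factorial_succ (J + 1 + d + J), pow_succ]
    push_cast at h3 h4 hk0 ⊢
    field_simp
    ring

lemma sum_factorial_eq_centralBinom_div {p : ℕ} [hp : Fact p.Prime] {j : ℕ} (hj : 1 ≤ j)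
    (hjp : 2 * j < p) :
    ∑ k ∈ Icc j (p - 1 - j), ((k - 1)! : ZMod p) ^ 2 / ((k - j)! * (k + j)!) =
      ((2 * j).choose j : ℕ) / (j : ZMod p) ^ 2 := by
  rw [sum_factorial_telescope_right hj (by omega) (by omega), centralBinom_eq_div (by omega),
    show p - 1 - j + j = p - 1 by omega, ZMod.wilsons_lemma]
  congr 1
  have e1 := factorial_mul_factorial_sub (p := p) (a := j) (b := p - 1 - j) (by omega)
  have e2 := factorial_mul_factorial_sub (p := p) (a := 2 * j) (b := p - 1 - j - j) (by omega)
  have h1 := factorial_ne_zero (p := p) (k := j) (by omega)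
  have h2 := factorial_ne_zero (p := p) (k := p - 1 - j - j) (by omega)
  rw [pow_succ, pow_mul, neg_one_sq, one_pow, one_mul] at e2
  have e3 : ((j ! : ZMod p) * (p - 1 - j)!) ^ 2 = 1 := by
    rw [e1, ← pow_mul, mul_comm (j + 1), pow_mul, neg_one_sq, one_pow]
  rw [div_eq_div_iff (mul_ne_zero h2 (by simp)) (pow_ne_zero _ h1)]
  linear_combination e3 + e2

/-- The term produced by the upper end of the telescoping sum over `j`. -/
lemma telescope_endpoint {p : ℕ} [hp : Fact p.Prime] (hp2 : 2 < p) {i : ℕ} (hi : 1 ≤ i)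
    (hip : 2 * i < p) :
    ((p - i - 1)! : ZMod p) ^ 2 * (∑ j ∈ Icc 1 (i - 1),
        (-1 : ZMod p) ^ j / ((p - i - j)! * (p - i + j)!)) =
      -(((p - i : ℕ) : ZMod p) ^ 2)⁻¹ / 2 -
        (-1) ^ i * ((2 * i).choose i : ℕ) / (i : ZMod p) ^ 2 / 4 := by
  rw [sum_factorial_telescope_left hp2 (by omega) (by omega) (by omega),
    centralBinom_eq_div (by omega), show p - i + (i - 1) = p - 1 by omega, ZMod.wilsons_lemma]
  have e1 := factorial_mul_factorial_sub (p := p) (a := i) (b := p - i - 1) (by omega)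
  have e2 := factorial_mul_factorial_sub (p := p) (a := 2 * (i - 1)) (b := p - i - (i - 1))
    (by omega)
  rw [pow_succ, pow_mul, neg_one_sq, one_pow, one_mul] at e2
  have hfac : ((p - i)! : ZMod p) = -i * (p - i - 1)! := by
    rw [← natCast_sub_natCast_self (by omega : i ≤ p), ← Nat.cast_mul,
      Nat.mul_factorial_pred (by omega)]
  rw [hfac, natCast_sub_natCast_self (by omega : i ≤ p)]
  have h1 := factorial_ne_zero (p := p) (k := i) (by omega)
  have h2 := factorial_ne_zero (p := p) (k := p - i - (i - 1)) (by omega)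
  have h3 := factorial_ne_zero (p := p) (k := p - i - 1) (by omega)
  have hi0 : (i : ZMod p) ≠ 0 := natCast_ne_zero_of_lt hi (by omega)
  have h20 : (2 : ZMod p) ≠ 0 := by
    exact_mod_cast natCast_ne_zero_of_lt (p := p) (k := 2) (by omega) hp2
  have h40 : (4 : ZMod p) ≠ 0 := by
    rw [show (4 : ZMod p) = 2 * 2 by norm_num]
    exact mul_ne_zero h20 h20
  have e3 : ((p - i - 1)! : ZMod p) ^ 2 = 1 / (i ! : ZMod p) ^ 2 := by
    rw [eq_div_iff (pow_ne_zero _ h1), ← mul_pow, mul_comm, e1, ← pow_mul, mul_comm (i + 1),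
      pow_mul, neg_one_sq, one_pow]
  have e4 : ((p - i - (i - 1))! : ZMod p) = -1 / (2 * (i - 1))! := by
    rw [eq_div_iff (factorial_ne_zero (by omega)), mul_comm, e2]
  have h5 := factorial_ne_zero (p := p) (k := 2 * (i - 1)) (by omega)
  rw [mul_pow, e3, e4]
  obtain ⟨m, rfl⟩ : ∃ m, i = m + 1 := ⟨i - 1, by omega⟩
  rw [Nat.add_sub_cancel] at *
  rw [show 2 * (m + 1) = 2 * m + 1 + 1 by ring, Nat.factorial_succ (2 * m + 1),
    Nat.factorial_succ (2 * m), pow_succ]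
  push_cast at hi0 ⊢
  field_simp
  ring

lemma telescope_lower_half {p : ℕ} [hp : Fact p.Prime] {k : ℕ} (hk : 1 ≤ k)
    (hkp : 2 * k < p) :
    ((k - 1)! : ZMod p) ^ 2 * (∑ j ∈ Icc 1 k, (-1 : ZMod p) ^ j / ((k - j)! * (k + j)!)) =
      -((k : ZMod p) ^ 2)⁻¹ / 2 := by
  rw [sum_factorial_telescope_left (by omega) hk le_rfl (by omega), sub_self,
    ← Nat.mul_factorial_pred (by omega : k ≠ 0)]
  have h1 := factorial_ne_zero (p := p) (k := k - 1) (by omega)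
  have hk0 : (k : ZMod p) ≠ 0 := natCast_ne_zero_of_lt hk (by omega)
  have h20 : (2 : ZMod p) ≠ 0 := by
    exact_mod_cast natCast_ne_zero_of_lt (p := p) (k := 2) (by omega) (by omega)
  push_cast
  field_simp
  ring

lemma sum_neg_one_pow_mul_centralBinom_div_sq {p h : ℕ} [hp : Fact p.Prime] (hp5 : 5 < p)
    (hh : p = 2 * h + 1) :
    ∑ j ∈ Icc 1 h, (-1) ^ j * ((2 * j).choose j : ℕ) / (j : ZMod p) ^ 2 = 0 := by
  set S := ∑ j ∈ Icc 1 h, (-1) ^ j * ((2 * j).choose j : ℕ) / (j : ZMod p) ^ 2 with hS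
  have key : S = ∑ k ∈ Icc 1 (p - 1), ((k - 1)! : ZMod p) ^ 2 *
      ∑ j ∈ Icc 1 (min k (p - 1 - k)), (-1 : ZMod p) ^ j / ((k - j)! * (k + j)!) := by
    have : S = ∑ j ∈ Icc 1 h, ∑ k ∈ Icc j (p - 1 - j),
        ((k - 1)! : ZMod p) ^ 2 * ((-1 : ZMod p) ^ j / ((k - j)! * (k + j)!)) := by
      refine Finset.sum_congr rfl fun j hj => ?_
      rw [Finset.mem_Icc] at hj
      rw [mul_div_assoc, ← sum_factorial_eq_centralBinom_div hj.1 (by omega), Finset.mul_sum]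
      refine Finset.sum_congr rfl fun k _ => ?_
      ring
    rw [this]
    simp_rw [Finset.mul_sum]
    refine Finset.sum_comm' fun j k => ?_
    simp only [Finset.mem_Icc, le_min_iff]
    omega
  have split : ∀ f : ℕ → ZMod p, ∑ k ∈ Icc 1 (p - 1), f k =
      ∑ k ∈ Icc 1 h, f k + ∑ k ∈ Icc 1 h, f (p - k) := by
    intro f
    have hrefl : ∑ k ∈ Icc 1 h, f (p - k) = ∑ k ∈ Ioc h (p - 1), f k := by
      refine Finset.sum_nbij' (fun k => p - k) (fun k => p - k) ?_ ?_ ?_ ?_ (fun _ _ => rfl) <;>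
      · intro k hk
        simp only [Finset.mem_Icc, Finset.mem_Ioc] at hk ⊢
        omega
    rw [hrefl, ← zero_add 1, Finset.Icc_add_one_left_eq_Ioc, Finset.Icc_add_one_left_eq_Ioc,
      zero_add]
    exact (Finset.sum_Ioc_consecutive f (by omega) (by omega)).symm
  have hsq := sum_inv_sq (p := p) (by omega)
  rw [split] at key hsq
  have hlow : ∑ k ∈ Icc 1 h, ((k - 1)! : ZMod p) ^ 2 *
      ∑ j ∈ Icc 1 (min k (p - 1 - k)), (-1 : ZMod p) ^ j / ((k - j)! * (k + j)!) =
      -(∑ k ∈ Icc 1 h, ((k : ZMod p) ^ 2)⁻¹) / 2 := by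
    rw [← Finset.sum_neg_distrib, Finset.sum_div]
    refine Finset.sum_congr rfl fun k hk => ?_
    rw [Finset.mem_Icc] at hk
    rw [min_eq_left (by omega), telescope_lower_half hk.1 (by omega)]
  have hhigh : ∑ k ∈ Icc 1 h, ((p - k - 1)! : ZMod p) ^ 2 *
      ∑ j ∈ Icc 1 (min (p - k) (p - 1 - (p - k))),
        (-1 : ZMod p) ^ j / ((p - k - j)! * (p - k + j)!) =
      -(∑ k ∈ Icc 1 h, (((p - k : ℕ) : ZMod p) ^ 2)⁻¹) / 2 - S / 4 := by
    rw [← Finset.sum_neg_distrib, Finset.sum_div, hS, Finset.sum_div, ← Finset.sum_sub_distrib]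
    refine Finset.sum_congr rfl fun k hk => ?_
    rw [Finset.mem_Icc] at hk
    rw [← telescope_endpoint (by omega) hk.1 (by omega),
      show min (p - k) (p - 1 - (p - k)) = k - 1 by omega]
  rw [hlow, hhigh] at key
  have h20 : (2 : ZMod p) ≠ 0 := by
    exact_mod_cast natCast_ne_zero_of_lt (p := p) (k := 2) (by omega) (by omega)
  have h40 : (4 : ZMod p) ≠ 0 := by
    exact_mod_cast natCast_ne_zero_of_lt (p := p) (k := 4) (by omega) (by omega)
  have h50 : (5 : ZMod p) ≠ 0 := by
    exact_mod_cast natCast_ne_zero_of_lt (p := p) (k := 5) (by omega) hp5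
  generalize ∑ k ∈ Icc 1 h, ((k : ZMod p) ^ 2)⁻¹ = A at key hsq
  rw [← neg_eq_iff_add_eq_zero.2 hsq] at key
  field_simp at key
  have h5S : 2 * (5 * S) = 0 := by linear_combination key
  exact (mul_eq_zero_iff_left h50).1 ((mul_eq_zero.1 h5S).resolve_left h20)

lemma sum_choose_sq_div_sq {p : ℕ} [hp : Fact p.Prime] {k : ℕ} (hk : 1 ≤ k) (hkp : 2 * k < p) :
    ∑ n ∈ Icc 1 (p - 1), ((n.choose k : ℕ) : ZMod p) ^ 2 / (n : ZMod p) ^ 2 =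
      -1 / (k : ZMod p) ^ 2 := by
  obtain ⟨j, rfl⟩ : ∃ j, k = j + 1 := ⟨k - 1, by omega⟩
  have hsum := sum_range_choose_sq (p := p) (j := j) (by omega)
  have hrange : range p = range (p - 1 + 1) := by rw [Nat.sub_add_cancel (by omega)]
  rw [hrange, Finset.sum_range_succ, choose_pred_prime_sq (by omega)] at hsum
  rw [← eq_neg_iff_add_eq_zero.2 hsum, Finset.sum_div, ← Finset.Ico_add_one_right_eq_Icc,
    Finset.sum_Ico_eq_sum_range, Nat.add_sub_cancel]
  refine Finset.sum_congr rfl fun m hm => ?_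
  rw [Finset.mem_range] at hm
  have hm0 := natCast_ne_zero_of_lt (p := p) (k := m + 1) (by omega) (by omega)
  have hj0 := natCast_ne_zero_of_lt (p := p) (k := j + 1) (by omega) (by omega)
  have h := congrArg (Nat.cast (R := ZMod p)) (Nat.add_one_mul_choose_eq m j)
  rw [add_comm 1 m, div_eq_div_iff (pow_ne_zero _ hm0) (pow_ne_zero _ hj0), ← mul_pow, ← mul_pow,
    ← Nat.cast_mul, ← h, ← Nat.cast_mul, mul_comm]

end ZMod

lemma g_neg_one_cast_zmod {p h n : ℕ} [Fact p.Prime] (hh : p = 2 * h + 1) (hn : n < p) :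
    (g (-1) n : ZMod p) = 1 + ∑ k ∈ Icc 1 h,
      (-1) ^ k * ((2 * k).choose k : ℕ) * ((n.choose k : ℕ) : ZMod p) ^ 2 := by
  have hp := (Fact.out : p.Prime).two_le
  have hg : (g (-1) n : ZMod p) = ∑ k ∈ range (n + 1),
      (-1) ^ k * ((2 * k).choose k : ℕ) * ((n.choose k : ℕ) : ZMod p) ^ 2 := by
    rw [g]
    push_cast
    refine Finset.sum_congr rfl fun k _ => ?_
    ring
  rw [hg, Finset.range_eq_Ico, Finset.sum_eq_sum_Ico_succ_bot (by omega), zero_add,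
    Finset.Ico_add_one_right_eq_Icc]
  congr 1
  · simp
  trans ∑ k ∈ Icc 1 (p - 1),
      (-1) ^ k * ((2 * k).choose k : ℕ) * ((n.choose k : ℕ) : ZMod p) ^ 2
  · refine Finset.sum_subset (Finset.Icc_subset_Icc_right (by omega)) fun k hk hkn => ?_
    rw [Finset.mem_Icc] at hk hkn
    rw [Nat.choose_eq_zero_of_lt (n := n) (by omega)]
    simp
  · refine (Finset.sum_subset (Finset.Icc_subset_Icc_right (by omega)) fun k hk hkh => ?_).symm
    rw [Finset.mem_Icc] at hk hkh
    rw [ZMod.centralBinom_eq_zero (by omega) (by omega)]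
    simp

lemma sum_g_neg_one_div_sq_zmod {p : ℕ} [hp : Fact p.Prime] (hp5 : 5 < p) :
    ∑ n ∈ Icc 1 (p - 1), (g (-1) n : ZMod p) / (n : ZMod p) ^ 2 = 0 := by
  obtain ⟨h, hh⟩ := hp.out.odd_of_ne_two (by omega)
  have hsum : ∀ n ∈ Icc 1 (p - 1), (g (-1) n : ZMod p) / (n : ZMod p) ^ 2 =
      ((n : ZMod p) ^ 2)⁻¹ + ∑ k ∈ Icc 1 h, (-1) ^ k * ((2 * k).choose k : ℕ) *
        (((n.choose k : ℕ) : ZMod p) ^ 2 / (n : ZMod p) ^ 2) := by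
    intro n hn
    rw [Finset.mem_Icc] at hn
    rw [g_neg_one_cast_zmod hh (by omega), add_div, one_div, Finset.sum_div]
    simp_rw [mul_div_assoc]
  rw [Finset.sum_congr rfl hsum, Finset.sum_add_distrib, ZMod.sum_inv_sq (by omega),
    Finset.sum_comm, zero_add, ← neg_zero, ← ZMod.sum_neg_one_pow_mul_centralBinom_div_sq hp5 hh,
    ← Finset.sum_neg_distrib]
  refine Finset.sum_congr rfl fun k hk => ?_
  rw [Finset.mem_Icc] at hk
  rw [← Finset.mul_sum, ZMod.sum_choose_sq_div_sq hk.1 (by omega)]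
  ring

/-- If `p ∤ d` and `d ^ 2 * x` is an integer divisible by `p`, then `x ≡ 0 (mod p)`. -/
lemma ratCongr_zero_of_mul_sq_eq {p : ℕ} [hp : Fact p.Prime] {x : ℚ} {d : ℕ} {N : ℤ}
    (hd : ¬p ∣ d) (hx : x * (d : ℚ) ^ 2 = N) (hN : (p : ℤ) ∣ N) : ratCongr p 1 x 0 := by
  rw [ratCongr, sub_zero, or_iff_not_imp_left]
  intro hx0
  have hd0 : (d : ℚ) ≠ 0 := by
    intro h
    exact hd (by simp [Nat.cast_eq_zero.1 h])
  have hN0 : N ≠ 0 := by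
    rintro rfl
    simp [hx0] at hx
    exact hd0 (by simp [hx])
  have hval := congrArg (padicValRat p) hx
  rw [padicValRat.mul hx0 (pow_ne_zero _ hd0), padicValRat.pow, padicValRat.of_nat,
    padicValNat.eq_zero_of_not_dvd hd, padicValRat.of_int] at hval
  have h1 : 1 ≤ padicValInt p N := by
    have := (padicValInt_dvd_iff (p := p) 1 N).1 (by simpa using hN)
    exact this.resolve_left hN0
  simp only [Nat.cast_zero, mul_zero, add_zero] at hval
  rw [hval]
  exact_mod_cast h1

theorem sum_g_neg_one_div_sq (p : ℕ) (hp : p.Prime) (hp5 : 5 < p) :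
    ratCongr p 1 (∑ k ∈ Finset.Icc 1 (p - 1), (g (-1) k : ℚ) / (k : ℚ) ^ 2) 0 := by
  have : Fact p.Prime := ⟨hp⟩
  refine ratCongr_zero_of_mul_sq_eq (d := (p - 1)!)
    (N := ∑ k ∈ Icc 1 (p - 1), g (-1) k * (((p - 1)! / k : ℕ) : ℤ) ^ 2) ?_ ?_ ?_
  · rw [hp.dvd_factorial]
    omega
  · simp only [Int.cast_sum, Int.cast_mul, Int.cast_pow, Int.cast_natCast]
    rw [Finset.sum_mul]
    refine Finset.sum_congr rfl fun k hk => ?_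
    rw [Finset.mem_Icc] at hk
    rw [Nat.cast_div (Nat.dvd_factorial hk.1 hk.2) (Nat.cast_ne_zero.2 (by omega))]
    ring
  · rw [← ZMod.intCast_zmod_eq_zero_iff_dvd]
    simp only [Int.cast_sum, Int.cast_mul, Int.cast_pow, Int.cast_natCast]
    rw [← mul_zero (((p - 1)! : ZMod p) ^ 2), ← sum_g_neg_one_div_sq_zmod hp5, Finset.mul_sum]
    refine Finset.sum_congr rfl fun k hk => ?_
    rw [Finset.mem_Icc] at hk
    rw [Nat.cast_div (Nat.dvd_factorial hk.1 hk.2) (ZMod.natCast_ne_zero_of_lt hk.1 (by omega))]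
    ring
end

section
/- Let p > 5 be a prime. Then ∑_{k=1}^{p-1} g_k(−1)/k ≡ 0 (mod p²). -/
open Finset Polynomial

lemma sum_range_eq_sum_zmod {M : Type*} [AddCommMonoid M] (p : ℕ) [NeZero p] (f : ZMod p → M) :
    ∑ k ∈ range p, f k = ∑ x : ZMod p, f x :=
  sum_bij' (fun k _ => (k : ZMod p)) (fun x _ => x.val) (fun _ _ => mem_univ _)
    (fun x _ => mem_range.2 x.val_lt) (fun _ hk => ZMod.val_cast_of_lt (mem_range.1 hk))
    (fun x _ => ZMod.natCast_zmod_val x) (fun _ _ => rfl)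

lemma sum_Ico_sub_eq {M : Type*} [AddCommMonoid M] (p : ℕ) (f : ℕ → M) :
    ∑ k ∈ Ico 1 p, f (p - k) = ∑ k ∈ Ico 1 p, f k := by
  refine sum_bij' (fun k _ => p - k) (fun k _ => p - k) ?_ ?_ ?_ ?_ ?_ <;>
    intro k hk <;> rw [mem_Ico] at hk <;> try rw [mem_Ico]
  all_goals omega

/-- The finite polylogarithm `∑_{0 < k < p} xᵏ / kᵈ`. -/
noncomputable def finitePolylog (F : Type*) [Field F] (p d : ℕ) : F[X] :=
  ∑ k ∈ Ico 1 p, C ((k : F) ^ d)⁻¹ * X ^ k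

section Field

variable {F : Type*} [Field F] {p : ℕ}

lemma natDegree_finitePolylog_le (d : ℕ) : (finitePolylog F p d).natDegree ≤ p :=
  natDegree_sum_le_of_forall_le _ _ fun _ hk =>
    (natDegree_C_mul_X_pow_le _ _).trans (mem_Ico.1 hk).2.le

lemma eval_zero_finitePolylog (d : ℕ) : (finitePolylog F p d).eval 0 = 0 := by
  rw [finitePolylog, eval_finsetSum]
  refine sum_eq_zero fun k hk => ?_
  have : k ≠ 0 := by have := (mem_Ico.1 hk).1; omega
  simp [this]

lemma eval_one_finitePolylog (d : ℕ) :
    (finitePolylog F p d).eval 1 = ∑ k ∈ Ico 1 p, ((k : F) ^ d)⁻¹ := by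
  simp [finitePolylog, eval_finsetSum]

/-- The polynomial form `∑_{0 < k < p} (x - 1)ᵏ x^(p - k) / kᵈ` of `xᵖ` times the finite
polylogarithm at `1 - 1 / x`. -/
noncomputable def reflectedPolylog (F : Type*) [Field F] (p d : ℕ) : F[X] :=
  ∑ k ∈ Ico 1 p, C ((k : F) ^ d)⁻¹ * ((X - 1) ^ k * X ^ (p - k))

lemma natDegree_reflectedPolylog_le (d : ℕ) : (reflectedPolylog F p d).natDegree ≤ p := by
  refine natDegree_sum_le_of_forall_le _ _ fun k hk => (natDegree_C_mul_le _ _).trans ?_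
  obtain ⟨_, hk⟩ := mem_Ico.1 hk
  have h1 : (X - 1 : F[X]).natDegree ≤ 1 := by simpa using (natDegree_X_sub_C (1 : F)).le
  have := natDegree_mul_le_of_le (natDegree_pow_le_of_le k h1)
    (natDegree_X_pow_le (R := F) (p - k))
  omega

lemma eval_zero_reflectedPolylog (d : ℕ) : (reflectedPolylog F p d).eval 0 = 0 := by
  rw [reflectedPolylog, eval_finsetSum]
  refine sum_eq_zero fun k hk => ?_
  have : p - k ≠ 0 := by have := (mem_Ico.1 hk).2; omega
  simp [this]

lemma eval_one_reflectedPolylog (d : ℕ) : (reflectedPolylog F p d).eval 1 = 0 := by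
  rw [reflectedPolylog, eval_finsetSum]
  refine sum_eq_zero fun k hk => ?_
  have : k ≠ 0 := by have := (mem_Ico.1 hk).1; omega
  simp [this]

/-- The polynomial form of `(1 - x)ᵖ` times `∑_{0 < k < p/2} (2k choose k) tᵏ / kᵈ`
at `t = -x / (1 - x)²`. -/
noncomputable def centralBinomPolylog (F : Type*) [Field F] (p d : ℕ) : F[X] :=
  ∑ k ∈ Ico 1 ((p + 1) / 2),
    C ((k.centralBinom : F) * ((k : F) ^ d)⁻¹) * ((-X) ^ k * (1 - X) ^ (p - 2 * k))

lemma natDegree_one_sub_X_le : (1 - X : F[X]).natDegree ≤ 1 := by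
  rw [← neg_sub, natDegree_neg]
  simpa using (natDegree_X_sub_C (1 : F)).le

lemma natDegree_centralBinomPolylog_le (d : ℕ) : (centralBinomPolylog F p d).natDegree ≤ p := by
  refine natDegree_sum_le_of_forall_le _ _ fun k hk => (natDegree_C_mul_le _ _).trans ?_
  obtain ⟨_, hk⟩ := mem_Ico.1 hk
  have h2 : (-X : F[X]).natDegree ≤ 1 := by simp
  have := natDegree_mul_le_of_le (natDegree_pow_le_of_le k h2)
    (natDegree_pow_le_of_le (p - 2 * k) (natDegree_one_sub_X_le (F := F)))
  omega

lemma eval_zero_centralBinomPolylog (d : ℕ) : (centralBinomPolylog F p d).eval 0 = 0 := by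
  rw [centralBinomPolylog, eval_finsetSum]
  refine sum_eq_zero fun k hk => ?_
  have : k ≠ 0 := by have := (mem_Ico.1 hk).1; omega
  simp [this]

lemma finitePolylog_zero [Fact p.Prime] : (1 - X) * finitePolylog F p 0 = X - X ^ p := by
  have := geom_sum_Ico_mul (X : F[X]) (Fact.out : p.Prime).one_le
  simp only [finitePolylog, pow_zero, inv_one, C_1, one_mul]
  linear_combination -this

end Field

section CharP

variable {F : Type*} [Field F] {p : ℕ} [CharP F p]

lemma natCast_ne_zero_of_mem_Ico {k : ℕ} (hk : k ∈ Ico 1 p) : (k : F) ≠ 0 := fun h =>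
  absurd (Nat.le_of_dvd (mem_Ico.1 hk).1 ((CharP.cast_eq_zero_iff F p k).1 h))
    (not_le.2 (mem_Ico.1 hk).2)

lemma natCast_sub_eq_neg {k : ℕ} (hk : k ≤ p) : ((p - k : ℕ) : F) = -k := by
  rw [Nat.cast_sub hk, CharP.cast_eq_zero, zero_sub]

lemma centralBinom_half_mem {k : ℕ} (hk : k ∈ Ico 1 ((p + 1) / 2)) : k ∈ Ico 1 p := by
  rw [mem_Ico] at *
  omega

lemma eval_one_centralBinomPolylog (hp2 : Odd p) (d : ℕ) :
    (centralBinomPolylog F p d).eval 1 = 0 := by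
  rw [centralBinomPolylog, eval_finsetSum]
  refine sum_eq_zero fun k hk => ?_
  have : p - 2 * k ≠ 0 := by
    have := (mem_Ico.1 hk).2
    obtain ⟨n, rfl⟩ := hp2
    omega
  simp [this]

lemma inv_pow_eq {x : F} (hx : x ≠ 0) (d : ℕ) : (x ^ d)⁻¹ = (x ^ (d + 1))⁻¹ * x := by
  rw [pow_succ]
  field_simp

lemma X_mul_derivative_finitePolylog (d : ℕ) :
    X * derivative (finitePolylog F p (d + 1)) = finitePolylog F p d := by
  simp only [finitePolylog, derivative_sum, mul_sum]
  refine sum_congr rfl fun k hk => ?_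
  rw [inv_pow_eq (natCast_ne_zero_of_mem_Ico hk) d, C_mul, derivative_C_mul, derivative_X_pow]
  obtain ⟨j, rfl⟩ := Nat.exists_eq_add_of_le' (mem_Ico.1 hk).1
  simp only [Nat.add_sub_cancel, map_natCast]
  ring

lemma derivative_reflectedPolylog (d : ℕ) :
    X * (1 - X) * derivative (reflectedPolylog F p (d + 1)) = -reflectedPolylog F p d := by
  simp only [reflectedPolylog, derivative_sum, mul_sum, ← sum_neg_distrib]
  refine sum_congr rfl fun k hk => ?_
  have hc : ((p - k : ℕ) : F[X]) = -k := by
    rw [← map_natCast C, natCast_sub_eq_neg (mem_Ico.1 hk).2.le, C_neg, map_natCast]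
  rw [inv_pow_eq (natCast_ne_zero_of_mem_Ico hk) d, C_mul, derivative_C_mul, derivative_mul,
    derivative_X_pow, derivative_pow, map_natCast, map_natCast, hc]
  obtain ⟨h0, hk⟩ := mem_Ico.1 hk
  obtain ⟨j, rfl⟩ := Nat.exists_eq_add_of_le' h0
  obtain ⟨i, rfl⟩ := Nat.exists_eq_add_of_lt hk
  rw [show j + 1 + i + 1 - (j + 1) = i + 1 by omega]
  simp only [Nat.add_sub_cancel, derivative_sub, derivative_X, derivative_one]
  ring

lemma derivative_centralBinomPolylog (hp2 : Odd p) (d : ℕ) :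
    X * (1 - X) * derivative (centralBinomPolylog F p (d + 1)) =
      (1 + X) * centralBinomPolylog F p d := by
  simp only [centralBinomPolylog, derivative_sum, mul_sum]
  refine sum_congr rfl fun k hk => ?_
  have hc : ((p - 2 * k : ℕ) : F[X]) = -(2 * k) := by
    have : 2 * k ≤ p := by have := (mem_Ico.1 hk).2; omega
    rw [← map_natCast C, natCast_sub_eq_neg this, C_neg, map_natCast]
    push_cast
    ring
  rw [inv_pow_eq (natCast_ne_zero_of_mem_Ico (centralBinom_half_mem hk)) d,
    ← mul_assoc (k.centralBinom : F), C_mul (b := (k : F)),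
    derivative_C_mul, derivative_mul, derivative_pow, derivative_pow, map_natCast, map_natCast, hc]
  obtain ⟨h0, hk⟩ := mem_Ico.1 hk
  obtain ⟨j, rfl⟩ := Nat.exists_eq_add_of_le' h0
  obtain ⟨n, rfl⟩ := hp2
  obtain ⟨i, hi⟩ : ∃ i, 2 * n + 1 - 2 * (j + 1) = i + 1 := ⟨2 * n - 2 * (j + 1), by omega⟩
  rw [hi]
  simp only [Nat.add_sub_cancel, derivative_sub, derivative_neg, derivative_X, derivative_one]
  ring

/-- A polynomial of degree at most `p` in characteristic `p` is determined by its derivative and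
its values at `0` and `1`. -/
lemma eq_of_derivative_eq {f g : F[X]} (hf : f.natDegree ≤ p) (hg : g.natDegree ≤ p)
    (hd : X * (1 - X) * derivative f = X * (1 - X) * derivative g)
    (h0 : f.eval 0 = g.eval 0) (h1 : f.eval 1 = g.eval 1) : f = g := by
  have hX : (X * (1 - X) : F[X]) ≠ 0 := by
    refine mul_ne_zero X_ne_zero fun h => ?_
    simpa using congrArg (eval 0) h
  have hd' : derivative (f - g) = 0 := by
    rw [derivative_sub, mul_left_cancel₀ hX hd, sub_self]
  have hc : ∀ k, k ≠ p → (f - g).coeff k = 0 := by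
    intro k hk
    rcases Nat.eq_zero_or_pos k with rfl | hk0
    · rw [coeff_zero_eq_eval_zero, eval_sub, h0, sub_self]
    rcases lt_or_gt_of_ne hk with hlt | hgt
    · have h := congrArg (fun q => coeff q (k - 1)) hd'
      simp only [coeff_derivative, coeff_zero] at h
      rw [Nat.sub_add_cancel hk0, ← Nat.cast_succ, Nat.succ_eq_add_one,
        Nat.sub_add_cancel hk0] at h
      exact (mul_eq_zero.1 h).resolve_right
        (natCast_ne_zero_of_mem_Ico (mem_Ico.2 ⟨hk0, hlt⟩))
    · exact coeff_eq_zero_of_natDegree_lt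
        (((natDegree_sub_le _ _).trans (max_le hf hg)).trans_lt hgt)
  have hm : f - g = C ((f - g).coeff p) * X ^ p := by
    ext k
    rw [coeff_C_mul_X_pow]
    split_ifs with h
    · rw [h]
    · exact hc k h
  have hv : (f - g).coeff p = 0 := by
    have := congrArg (eval 1) hm
    simpa [h1] using this.symm
  rw [hv] at hm
  exact sub_eq_zero.1 (by simpa using hm)

lemma two_ne_zero_of_odd (hp2 : Odd p) : (2 : F) ≠ 0 := fun h => by
  have h2 : p ∣ 2 := (CharP.cast_eq_zero_iff F p 2).1 (by exact_mod_cast h)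
  rcases (Nat.dvd_prime Nat.prime_two).1 h2 with h | h
  · exact CharP.char_ne_one F p h
  · rw [h] at hp2
    exact absurd hp2 (by decide)

lemma sum_Ico_eq_zero_of_odd {f : ℕ → F} (hp2 : Odd p)
    (hf : ∀ k ∈ Ico 1 p, f (p - k) = -f k) : ∑ k ∈ Ico 1 p, f k = 0 := by
  have h := sum_Ico_sub_eq p f
  rw [sum_congr rfl hf, sum_neg_distrib] at h
  refine (mul_eq_zero.1 ?_).resolve_left (two_ne_zero_of_odd (F := F) hp2)
  linear_combination -h

lemma sum_inv_eq_zero (hp2 : Odd p) : ∑ k ∈ Ico 1 p, ((k : F) ^ 1)⁻¹ = 0 :=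
  sum_Ico_eq_zero_of_odd hp2 fun k hk => by
    rw [natCast_sub_eq_neg (mem_Ico.1 hk).2.le, pow_one, pow_one, inv_neg]

lemma sum_alternating_inv_sq_eq_zero (hp2 : Odd p) :
    ∑ k ∈ Ico 1 p, (-1 : F) ^ k * ((k : F) ^ 2)⁻¹ = 0 :=
  sum_Ico_eq_zero_of_odd hp2 fun k hk => by
    have hk := (mem_Ico.1 hk).2.le
    have h : (-1 : F) ^ (p - k) * (-1) ^ k = -1 := by
      rw [← pow_add, Nat.sub_add_cancel hk, hp2.neg_one_pow]
    have h' : (-1 : F) ^ k * (-1) ^ k = 1 := by rw [← mul_pow]; simp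
    rw [natCast_sub_eq_neg hk, neg_sq]
    linear_combination (((k : F) ^ 2)⁻¹ * (-1) ^ k) * h - ((k : F) ^ 2)⁻¹ * (-1) ^ (p - k) * h'

lemma natCast_centralBinom_eq {n k : ℕ} (hn : p = 2 * n + 1) (hk : k ≤ n) :
    (k.centralBinom : F) = (-4) ^ k * (n.choose k : F) := by
  induction k with
  | zero => simp
  | succ k ih =>
    have hne : ((k + 1 : ℕ) : F) ≠ 0 :=
      natCast_ne_zero_of_mem_Ico (p := p) (mem_Ico.2 ⟨by omega, by omega⟩)
    refine mul_left_cancel₀ hne ?_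
    have h1 := congrArg (Nat.cast : ℕ → F) (Nat.succ_mul_centralBinom_succ k)
    have h2 := congrArg (Nat.cast : ℕ → F) (Nat.choose_succ_right_eq n k)
    have h3 : (2 * n + 1 : F) = 0 := by
      have := CharP.cast_eq_zero F p
      rw [hn] at this
      exact_mod_cast this
    rw [Nat.cast_mul, Nat.cast_mul, Nat.cast_sub (by omega)] at h2
    push_cast at h1 h2 ⊢
    rw [ih (by omega)] at h1
    rw [h1, pow_succ]
    linear_combination 4 * (-4) ^ k * h2 + 2 * (-4) ^ k * (n.choose k : F) * h3

end CharP

section Prime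

variable {F : Type*} [Field F] {p : ℕ} [Fact p.Prime] [CharP F p]

lemma sum_inv_sq_eq_zero (hp : 3 < p) : ∑ k ∈ Ico 1 p, ((k : F) ^ 2)⁻¹ = 0 := by
  have hz : ∑ k ∈ Ico 1 p, ((k : ZMod p) ^ 2)⁻¹ = 0 := by
    have h := sum_range_eq_sum_zmod p fun x => (x ^ 2)⁻¹
    rw [range_eq_Ico, sum_eq_sum_Ico_succ_bot (by omega)] at h
    simp only [Nat.cast_zero, ne_eq, OfNat.ofNat_ne_zero, not_false_eq_true, zero_pow, inv_zero,
      zero_add] at h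
    rw [h]
    simp only [← inv_pow]
    refine (Equiv.sum_comp (Equiv.inv (ZMod p)) fun x => x ^ 2).trans ?_
    exact FiniteField.sum_pow_lt_card_sub_one _ _ (by rw [ZMod.card]; omega)
  simpa using congrArg (ZMod.castHom (dvd_refl p) F) hz

lemma finitePolylog_one_comp (hp2 : Odd p) :
    (finitePolylog F p 1).comp (1 - X) = finitePolylog F p 1 := by
  have hX := X_mul_derivative_finitePolylog (F := F) (p := p) 0
  have h0 := finitePolylog_zero (F := F) (p := p)
  have hXc := congrArg (fun q => q.comp (1 - X)) hX
  have h0c := congrArg (fun q => q.comp (1 - X)) h0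
  simp only [mul_comp, sub_comp, X_comp, one_comp, pow_comp, zero_add] at hXc h0c hX
  rw [sub_pow_char, one_pow] at h0c
  have h1 : (finitePolylog F p 1).eval 1 = 0 := by
    rw [eval_one_finitePolylog, sum_inv_eq_zero hp2]
  refine eq_of_derivative_eq (p := p) ?_ (natDegree_finitePolylog_le 1) ?_ ?_ ?_
  · rw [natDegree_comp]
    exact (Nat.mul_le_mul (natDegree_finitePolylog_le 1) natDegree_one_sub_X_le).trans_eq
      (mul_one p)
  · rw [derivative_comp, derivative_sub, derivative_one, derivative_X]
    linear_combination -X * hXc - h0c - (1 - X) * hX - h0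
  · simp [h1, eval_zero_finitePolylog]
  · simp [h1, eval_zero_finitePolylog]

lemma reflectedPolylog_zero : reflectedPolylog F p 0 = X - X ^ p := by
  have hg := (Commute.all (X - 1 : F[X]) X).geom_sum₂_mul p
  rw [sub_pow_char, one_pow] at hg
  have hs : ∑ k ∈ range p, (X - 1 : F[X]) ^ k * X ^ (p - k) =
      X * ∑ k ∈ range p, (X - 1 : F[X]) ^ k * X ^ (p - 1 - k) := by
    rw [mul_sum]
    refine sum_congr rfl fun k hk => ?_
    rw [show p - k = p - 1 - k + 1 by have := mem_range.1 hk; omega]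
    ring
  rw [range_eq_Ico, sum_eq_sum_Ico_succ_bot (Fact.out : p.Prime).pos, ← range_eq_Ico] at hs
  simp only [reflectedPolylog, pow_zero, inv_one, C_1, one_mul, Nat.sub_zero, zero_add] at hs ⊢
  linear_combination hs - X * hg

lemma reflectedPolylog_one (hp2 : Odd p) : reflectedPolylog F p 1 = -finitePolylog F p 1 := by
  have hX := X_mul_derivative_finitePolylog (F := F) (p := p) 0
  have h0 := finitePolylog_zero (F := F) (p := p)
  have hr := derivative_reflectedPolylog (F := F) (p := p) 0
  rw [reflectedPolylog_zero] at hr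
  refine eq_of_derivative_eq (p := p) (natDegree_reflectedPolylog_le 1) ?_ ?_ ?_ ?_
  · rw [natDegree_neg]
    exact natDegree_finitePolylog_le 1
  · rw [derivative_neg]
    linear_combination hr + (1 - X) * hX + h0
  · simp [eval_zero_reflectedPolylog, eval_zero_finitePolylog]
  · rw [eval_neg, eval_one_reflectedPolylog, eval_one_finitePolylog, sum_inv_eq_zero hp2, neg_zero]

lemma reflectedPolylog_two (hp : 3 < p) (hp2 : Odd p) :
    reflectedPolylog F p 2 = finitePolylog F p 2 - (finitePolylog F p 2).comp (1 - X) := by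
  have hX := X_mul_derivative_finitePolylog (F := F) (p := p) 1
  have hXc := congrArg (fun q => q.comp (1 - X)) hX
  simp only [mul_comp, X_comp, finitePolylog_one_comp hp2] at hXc hX
  have hr := derivative_reflectedPolylog (F := F) (p := p) 1
  rw [reflectedPolylog_one hp2] at hr
  have h1 : (finitePolylog F p 2).eval 1 = 0 := by
    rw [eval_one_finitePolylog, sum_inv_sq_eq_zero hp]
  refine eq_of_derivative_eq (p := p) (natDegree_reflectedPolylog_le 2) ?_ ?_ ?_ ?_
  · refine (natDegree_sub_le _ _).trans (max_le (natDegree_finitePolylog_le 2) ?_)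
    rw [natDegree_comp]
    exact (Nat.mul_le_mul (natDegree_finitePolylog_le 2) natDegree_one_sub_X_le).trans_eq
      (mul_one p)
  · rw [derivative_sub, derivative_comp, derivative_sub, derivative_one, derivative_X]
    linear_combination hr - (1 - X) * hX - X * hXc
  · simp [h1, eval_zero_reflectedPolylog, eval_zero_finitePolylog]
  · simp [h1, eval_one_reflectedPolylog, eval_zero_finitePolylog]

lemma centralBinomPolylog_zero (hp2 : Odd p) :
    (1 + X) * centralBinomPolylog F p 0 = -2 * (X - X ^ p) := by
  obtain ⟨n, hn⟩ := hp2
  have hb := add_pow (4 * X : F[X]) ((1 - X) ^ 2) n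
  rw [range_eq_Ico, sum_eq_sum_Ico_succ_bot (by omega)] at hb
  have ht : centralBinomPolylog F p 0 = (1 - X) * ∑ k ∈ Ico 1 (n + 1),
      (4 * X : F[X]) ^ k * ((1 - X) ^ 2) ^ (n - k) * (n.choose k : F[X]) := by
    rw [centralBinomPolylog, show (p + 1) / 2 = n + 1 by omega, mul_sum]
    refine sum_congr rfl fun k hk => ?_
    have hk := (mem_Ico.1 hk).2
    rw [natCast_centralBinom_eq hn (by omega), pow_zero, inv_one, mul_one,
      show p - 2 * k = 2 * (n - k) + 1 by omega, C_mul, C_pow, map_natCast, C_neg,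
      show (C 4 : F[X]) = 4 from rfl, mul_pow, ← pow_mul, pow_succ (1 - X),
      neg_pow (4 : F[X]), neg_pow (X : F[X])]
    have : (-1 : F[X]) ^ k * (-1) ^ k = 1 := by rw [← mul_pow]; simp
    linear_combination (4 ^ k * (n.choose k : F[X]) * X ^ k * (1 - X) ^ (2 * (n - k)) * (1 - X))
      * this
  have hs : centralBinomPolylog F p 0 + (1 - X) ^ p = (1 - X) * (1 + X) ^ (2 * n) := by
    rw [show (1 + X : F[X]) ^ (2 * n) = ((4 * X) + (1 - X) ^ 2) ^ n by
      rw [pow_mul]; congr 1; ring, hb, ht]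
    rw [zero_add, pow_zero, Nat.sub_zero, Nat.choose_zero_right, Nat.cast_one, ← pow_mul,
      show (1 - X : F[X]) ^ p = (1 - X) ^ (2 * n) * (1 - X) by rw [← pow_succ, ← hn]]
    ring
  have hc : (1 + X : F[X]) ^ (2 * n) * (1 + X) = 1 + X ^ p := by
    rw [← pow_succ, ← hn, add_pow_char, one_pow]
  have hc' : (1 - X : F[X]) ^ p = 1 - X ^ p := by rw [sub_pow_char, one_pow]
  linear_combination (1 + X) * hs + (1 - X) * hc - (1 + X) * hc'

lemma centralBinomPolylog_one (hp2 : Odd p) :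
    centralBinomPolylog F p 1 = C (-2) * finitePolylog F p 1 := by
  have hX := X_mul_derivative_finitePolylog (F := F) (p := p) 0
  have h0 := finitePolylog_zero (F := F) (p := p)
  have hr := derivative_centralBinomPolylog (F := F) hp2 0
  rw [centralBinomPolylog_zero hp2] at hr
  have h2 : (C (-2) : F[X]) = -2 := by rw [C_neg]; rfl
  refine eq_of_derivative_eq (p := p) (natDegree_centralBinomPolylog_le 1)
    ((natDegree_C_mul_le _ _).trans (natDegree_finitePolylog_le 1)) ?_ ?_ ?_
  · rw [derivative_C_mul, h2]
    linear_combination hr + 2 * (1 - X) * hX + 2 * h0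
  · simp [eval_zero_centralBinomPolylog, eval_zero_finitePolylog]
  · rw [eval_mul, eval_one_centralBinomPolylog hp2, eval_one_finitePolylog, sum_inv_eq_zero hp2,
      mul_zero]

lemma centralBinomPolylog_two (hp : 3 < p) (hp2 : Odd p) :
    centralBinomPolylog F p 2 =
      C 4 * (finitePolylog F p 2).comp (1 - X) - C 2 * finitePolylog F p 2 := by
  have hX := X_mul_derivative_finitePolylog (F := F) (p := p) 1
  have hXc := congrArg (fun q => q.comp (1 - X)) hX
  simp only [mul_comp, X_comp, finitePolylog_one_comp hp2] at hXc hX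
  have hr := derivative_centralBinomPolylog (F := F) hp2 1
  rw [centralBinomPolylog_one hp2, show (C (-2) : F[X]) = -2 by rw [C_neg]; rfl] at hr
  have h1 : (finitePolylog F p 2).eval 1 = 0 := by
    rw [eval_one_finitePolylog, sum_inv_sq_eq_zero hp]
  refine eq_of_derivative_eq (p := p) (natDegree_centralBinomPolylog_le 2) ?_ ?_ ?_ ?_
  · refine (natDegree_sub_le _ _).trans (max_le ((natDegree_C_mul_le _ _).trans ?_)
      ((natDegree_C_mul_le _ _).trans (natDegree_finitePolylog_le 2)))
    rw [natDegree_comp]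
    exact (Nat.mul_le_mul (natDegree_finitePolylog_le 2) natDegree_one_sub_X_le).trans_eq
      (mul_one p)
  · rw [derivative_sub, derivative_C_mul, derivative_C_mul, derivative_comp, derivative_sub,
      derivative_one, derivative_X, show (C 4 : F[X]) = 4 from rfl, show (C 2 : F[X]) = 2 from rfl]
    linear_combination hr + 2 * (1 - X) * hX + 4 * X * hXc
  · simp [h1, eval_zero_centralBinomPolylog, eval_zero_finitePolylog]
  · simp [h1, eval_one_centralBinomPolylog hp2, eval_zero_finitePolylog]

end Prime

section AlternatingCentralBinom

variable {F : Type*} [Field F] {p : ℕ} [Fact p.Prime] [CharP F p]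

lemma finitePolylog_two_sq (hp2 : Odd p) (x : F) :
    (finitePolylog F p 2).eval (x ^ 2) =
      2 * ((1 + x ^ p) * (finitePolylog F p 2).eval x +
        (1 - x ^ p) * (finitePolylog F p 2).eval (-x)) := by
  have hL (y : F) : (finitePolylog F p 2).eval y = ∑ k ∈ range p, ((k : F) ^ 2)⁻¹ * y ^ k := by
    rw [range_eq_Ico, sum_eq_sum_Ico_succ_bot (Fact.out : p.Prime).pos]
    simp [finitePolylog, eval_finsetSum]
  let φ (j : ℕ) : F := (1 + (-1) ^ j) * (((j : F) ^ 2)⁻¹ * x ^ j)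
  have hsplit : ∑ j ∈ range (p + p), φ j = (1 + x ^ p) * (finitePolylog F p 2).eval x +
      (1 - x ^ p) * (finitePolylog F p 2).eval (-x) := by
    rw [sum_range_add, hL, hL, mul_sum, mul_sum, ← sum_add_distrib, ← sum_add_distrib]
    refine sum_congr rfl fun k _ => ?_
    simp only [φ, Nat.cast_add, CharP.cast_eq_zero, zero_add, pow_add, hp2.neg_one_pow]
    rw [neg_pow x]
    ring
  have hpair (N : ℕ) : ∑ j ∈ range (N + N), φ j = ∑ k ∈ range N, φ (2 * k) := by
    induction N with
    | zero => simp
    | succ N ih =>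
      have h : φ (N + N + 1) = 0 := by simp [φ, pow_add, ← mul_pow]
      rw [sum_range_succ _ N, ← ih, show N + 1 + (N + 1) = N + N + 1 + 1 by omega,
        sum_range_succ, sum_range_succ, h, add_zero, two_mul]
  have h2 := two_ne_zero_of_odd (F := F) hp2
  rw [← hsplit, hpair, hL, mul_sum]
  refine sum_congr rfl fun k _ => ?_
  simp only [φ, pow_mul, neg_one_sq, one_pow, Nat.cast_mul, Nat.cast_ofNat, mul_pow, mul_inv]
  field_simp
  ring

lemma eval_reflectedPolylog_two {a : F} (ha : a ^ 2 = 1 - a) :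
    (reflectedPolylog F p 2).eval a = a ^ p * (finitePolylog F p 2).eval (-a) := by
  simp only [reflectedPolylog, finitePolylog, eval_finsetSum, mul_sum]
  refine sum_congr rfl fun k hk => ?_
  obtain ⟨i, rfl⟩ := Nat.exists_eq_add_of_lt (mem_Ico.1 hk).2
  simp only [eval_mul, eval_C, eval_pow, eval_sub, eval_X, eval_one]
  rw [show k + i + 1 - k = i + 1 by omega, show a - 1 = -a * a by linear_combination ha, mul_pow]
  ring

/-- The dilogarithm relation at the golden ratio. -/
lemma finitePolylog_two_golden (hp : 5 < p) (hp2 : Odd p) {a : F} (ha : a ^ 2 = 1 - a) :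
    (finitePolylog F p 2).eval (a ^ 2) = 2 * (finitePolylog F p 2).eval a := by
  have h1 := finitePolylog_two_sq hp2 a
  have h2 := congrArg (eval a) (reflectedPolylog_two (F := F) (by omega) hp2)
  rw [eval_reflectedPolylog_two ha, eval_sub, eval_comp, eval_sub, eval_one, eval_X, ← ha] at h2
  have hb : (a ^ p) ^ 2 = 1 - a ^ p := by
    rw [← pow_mul, mul_comm, pow_mul, ha, sub_pow_char, one_pow]
  have h0 : 2 - a ^ p ≠ 0 := by
    intro h
    have h5 : ((5 : ℕ) : F) = 0 := by
      push_cast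
      linear_combination hb + (a ^ p + 3) * h
    have := Nat.le_of_dvd (by norm_num) ((CharP.cast_eq_zero_iff F p 5).1 h5)
    omega
  refine mul_left_cancel₀ h0 ?_
  set b := a ^ p
  set u := eval (a ^ 2) (finitePolylog F p 2)
  set v := eval a (finitePolylog F p 2)
  set w := eval (-a) (finitePolylog F p 2)
  linear_combination b * h1 + 2 * (1 - b) * h2 + 2 * v * hb

lemma sum_alternating_centralBinom_eq_zero (hp : 5 < p) (hp2 : Odd p) :
    ∑ k ∈ Ico 1 ((p + 1) / 2), (-1 : ZMod p) ^ k * (k.centralBinom : ZMod p) *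
      ((k : ZMod p) ^ 2)⁻¹ = 0 := by
  let F := AlgebraicClosure (ZMod p)
  obtain ⟨a, ha⟩ : ∃ a : F, a ^ 2 = 1 - a := by
    have h2 : (2 : F) ≠ 0 := by
      have := natCast_ne_zero_of_mem_Ico (F := F) (p := p) (k := 2) (mem_Ico.2 ⟨by omega, by omega⟩)
      exact_mod_cast this
    obtain ⟨s, hs⟩ := IsAlgClosed.exists_pow_nat_eq (5 : F) (n := 2) (by norm_num)
    have hi : (2 : F) * 2⁻¹ = 1 := mul_inv_cancel₀ h2
    refine ⟨(s - 1) * 2⁻¹, ?_⟩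
    linear_combination (2⁻¹ : F) ^ 2 * hs + ((3 - s) * 2⁻¹ + 1) * hi
  have hP := congrArg (eval (a ^ 2)) (centralBinomPolylog_two (F := F) (by omega) hp2)
  have ha' : 1 - a ^ 2 = a := by linear_combination -ha
  have ha0 : a ≠ 0 := by
    rintro rfl
    simp at ha
  simp only [eval_sub, eval_mul, eval_C, eval_comp, eval_one, eval_X, ha',
    finitePolylog_two_golden hp hp2 ha] at hP
  have hS : eval (a ^ 2) (centralBinomPolylog F p 2) = a ^ p * algebraMap (ZMod p) F
      (∑ k ∈ Ico 1 ((p + 1) / 2), (-1 : ZMod p) ^ k * (k.centralBinom : ZMod p) *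
        ((k : ZMod p) ^ 2)⁻¹) := by
    simp only [centralBinomPolylog, eval_finsetSum, map_sum, mul_sum]
    refine sum_congr rfl fun k hk => ?_
    have hk : 2 * k ≤ p := by have := (mem_Ico.1 hk).2; omega
    simp only [eval_mul, eval_C, eval_pow, eval_neg, eval_sub, eval_one, eval_X, ha', map_mul,
      map_pow, map_neg, map_one, map_natCast, map_inv₀]
    have : a ^ p = (a ^ 2) ^ k * a ^ (p - 2 * k) := by
      rw [← pow_mul, ← pow_add, Nat.add_sub_cancel' hk]
    rw [this, neg_pow]
    ring
  rw [hS] at hP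
  have := (mul_eq_zero.1 (hP.trans (by ring))).resolve_left (pow_ne_zero p ha0)
  exact (map_eq_zero _).1 this

end AlternatingCentralBinom

section AperyPolynomial

open fwdDiff in
lemma alternating_sum_choose_mul_choose_add (N l : ℕ) :
    ∑ i ∈ range (N + 1), (-1 : ℤ) ^ (N - i) * N.choose i * ((N + l + i).choose (N + l) : ℤ) =
      ((N + l).choose l : ℤ) := by
  have h := fwdDiff_iter_eq_sum_shift 1 (fun x : ℕ => (x.choose (N + l) : ℤ)) N (N + l)
  rw [fwdDiff_iter_choose] at h
  simpa using h.symm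

lemma choose_mul_choose_mul_choose_sq (j i r : ℕ) :
    ((j + i + r).choose (j + i) : ℚ) * ((j + i + r + (j + i)).choose (j + i) : ℚ) *
        ((j + i).choose j : ℚ) ^ 2 =
      ((i + r + 2 * j).factorial / ((i + r).factorial * j.factorial ^ 2) : ℚ) *
        (((i + r).choose i : ℚ) * ((i + r + 2 * j + i).choose (i + r + 2 * j) : ℚ)) := by
  have hf (m : ℕ) : (m.factorial : ℚ) ≠ 0 := Nat.cast_ne_zero.2 m.factorial_ne_zero
  rw [add_comm (j + i + r) (j + i), Nat.cast_add_choose, Nat.cast_add_choose, Nat.cast_add_choose,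
    Nat.cast_add_choose, Nat.cast_add_choose,
    show j + i + (j + i + r) = i + r + 2 * j + i by ring]
  have := hf (j + i + r)
  have := hf (j + i)
  have := hf (i + r)
  have := hf (i + r + 2 * j)
  have := hf i
  have := hf j
  have := hf r
  field_simp

lemma centralBinom_mul_sum_choose (N j : ℕ) :
    (j.centralBinom : ℤ) * ∑ k ∈ range (j + N + 1), (-1) ^ (j + N + k) *
        (((j + N).choose k * (j + N + k).choose k : ℕ) : ℤ) * (k.choose j : ℤ) ^ 2 =
      (((j + N).choose j * (j + N + j).choose j : ℕ) : ℤ) ^ 2 := by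
  have hf (m : ℕ) : (m.factorial : ℚ) ≠ 0 := Nat.cast_ne_zero.2 m.factorial_ne_zero
  rw [add_assoc, sum_range_add, sum_eq_zero, zero_add]
  swap
  · intro k hk
    rw [Nat.choose_eq_zero_of_lt (mem_range.1 hk)]
    simp
  have hs := congrArg (Int.cast : ℤ → ℚ) (alternating_sum_choose_mul_choose_add N (2 * j))
  have ht : ∀ i ∈ range (N + 1), (-1 : ℚ) ^ (j + N + (j + i)) *
      (((j + N).choose (j + i) : ℚ) * ((j + N + (j + i)).choose (j + i) : ℚ)) *
        ((j + i).choose j : ℚ) ^ 2 =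
      ((N + 2 * j).factorial / (N.factorial * j.factorial ^ 2) : ℚ) *
        ((-1) ^ (N - i) * (N.choose i : ℚ) * ((N + 2 * j + i).choose (N + 2 * j) : ℚ)) := by
    intro i hi
    obtain ⟨r, rfl⟩ := Nat.exists_eq_add_of_le (Nat.lt_succ_iff.1 (mem_range.1 hi))
    have h := choose_mul_choose_mul_choose_sq j i r
    rw [show i + r - i = r by omega, show j + (i + r) + (j + i) = 2 * (j + i) + r by ring, pow_add,
      pow_mul, neg_one_sq, one_pow, one_mul, mul_assoc, ← add_assoc,
      show 2 * (j + i) + r = j + i + r + (j + i) by ring, h]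
    ring
  have hq : (j.centralBinom : ℚ) * ∑ i ∈ range (N + 1), (-1) ^ (j + N + (j + i)) *
        (((j + N).choose (j + i) * (j + N + (j + i)).choose (j + i) : ℕ) : ℤ) *
          ((j + i).choose j : ℚ) ^ 2 =
      (((j + N).choose j * (j + N + j).choose j : ℕ) : ℚ) ^ 2 := by
    push_cast at hs ⊢
    rw [sum_congr rfl ht, ← mul_sum, hs, Nat.centralBinom, two_mul, Nat.cast_add_choose,
      add_comm (j + N) j, Nat.cast_add_choose, Nat.cast_add_choose, add_comm N (j + j),
      Nat.cast_add_choose, add_assoc j j N]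
    have := hf (j + N)
    have := hf (j + j)
    have := hf N
    have := hf j
    field_simp
  exact_mod_cast hq

/-- Expression of the Apéry polynomial `∑ j, (n choose j)² (n + j choose j)² xʲ` through `g`. -/
lemma sum_choose_mul_g (x : ℤ) (n : ℕ) :
    ∑ k ∈ range (n + 1), (-1) ^ (n + k) * ((n.choose k * (n + k).choose k : ℕ) : ℤ) * g x k =
      ∑ j ∈ range (n + 1), ((n.choose j * (n + j).choose j : ℕ) : ℤ) ^ 2 * x ^ j := by
  have hg : ∀ k ∈ range (n + 1), g x k =
      ∑ j ∈ range (n + 1), (k.choose j : ℤ) ^ 2 * (j.centralBinom : ℤ) * x ^ j := by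
    intro k hk
    refine sum_subset (range_subset_range.2 (by have := mem_range.1 hk; omega)) ?_
    intro j _ hj
    rw [Nat.choose_eq_zero_of_lt (by rw [mem_range] at hj; omega)]
    simp
  rw [sum_congr rfl fun k hk => by rw [hg k hk, mul_sum], sum_comm]
  refine sum_congr rfl fun j hj => ?_
  obtain ⟨N, rfl⟩ := Nat.exists_eq_add_of_le (Nat.lt_succ_iff.1 (mem_range.1 hj))
  rw [← centralBinom_mul_sum_choose, mul_sum, sum_mul]
  exact sum_congr rfl fun k _ => by ring

end AperyPolynomial

section ModPrime

variable {p : ℕ} [Fact p.Prime]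

lemma sum_eval_zmod_eq_zero {f : (ZMod p)[X]} (hf : f.natDegree < p - 1) :
    ∑ m ∈ range p, f.eval (m : ZMod p) = 0 := by
  rw [sum_range_eq_sum_zmod p fun x => f.eval x]
  simp only [eval_eq_sum_range]
  rw [sum_comm]
  refine sum_eq_zero fun i hi => ?_
  rw [← mul_sum, FiniteField.sum_pow_lt_card_sub_one, mul_zero]
  rw [ZMod.card]
  have := mem_range.1 hi
  omega

lemma sum_choose_sq_eq_zero {l : ℕ} (hl : 2 * l < p - 1) :
    ∑ m ∈ range p, (m.choose l : ZMod p) ^ 2 = 0 := by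
  have hne : (l.factorial : ZMod p) ≠ 0 := by
    rw [ne_eq, ZMod.natCast_eq_zero_iff, (Fact.out : p.Prime).dvd_factorial]
    omega
  have hd : (descPochhammer (ZMod p) l ^ 2).natDegree < p - 1 := by
    rwa [natDegree_pow, descPochhammer_natDegree]
  refine (mul_eq_zero.1 ?_).resolve_left (pow_ne_zero 2 hne)
  rw [← sum_eval_zmod_eq_zero hd, mul_sum]
  refine sum_congr rfl fun m _ => ?_
  rw [eval_pow, descPochhammer_eval_eq_descFactorial, Nat.descFactorial_eq_factorial_mul_choose]
  push_cast
  ring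

lemma choose_pred_prime_sq {l : ℕ} (hl : l < p) : ((p - 1).choose l : ZMod p) ^ 2 = 1 := by
  induction l with
  | zero => simp
  | succ l ih =>
    have h := Nat.choose_succ_succ' (p - 1) l
    rw [Nat.sub_add_cancel (Fact.out : p.Prime).one_le] at h
    have h0 : ((p.choose (l + 1) : ℕ) : ZMod p) = 0 := by
      rw [ZMod.natCast_eq_zero_iff]
      exact (Fact.out : p.Prime).dvd_choose_self (by omega) hl
    rw [h, Nat.cast_add] at h0
    rw [← ih (by omega), eq_neg_of_add_eq_zero_right h0, neg_sq]

lemma sum_choose_sq_mul_inv_sq {k : ℕ} (hk : k ∈ Ico 1 ((p + 1) / 2)) :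
    ∑ n ∈ Ico 1 p, (n.choose k : ZMod p) ^ 2 * ((n : ZMod p) ^ 2)⁻¹ = -((k : ZMod p) ^ 2)⁻¹ := by
  have hk0 : (k : ZMod p) ≠ 0 := natCast_ne_zero_of_mem_Ico (p := p) (centralBinom_half_mem hk)
  obtain ⟨hk1, hkp⟩ := mem_Ico.1 hk
  obtain ⟨l, rfl⟩ := Nat.exists_eq_add_of_le' hk1
  have h : ∀ n ∈ Ico 1 p, (n.choose (l + 1) : ZMod p) ^ 2 * ((n : ZMod p) ^ 2)⁻¹ =
      (((l + 1 : ℕ) : ZMod p) ^ 2)⁻¹ * ((n - 1).choose l : ZMod p) ^ 2 := by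
    intro n hn
    have hn0 : (n : ZMod p) ≠ 0 := natCast_ne_zero_of_mem_Ico hn
    have h := congrArg (Nat.cast : ℕ → ZMod p) (Nat.add_one_mul_choose_eq (n - 1) l)
    rw [Nat.sub_add_cancel (mem_Ico.1 hn).1, Nat.cast_mul, Nat.cast_mul] at h
    field_simp
    rw [← mul_pow, ← mul_pow, h, mul_comm]
  have hp := (Fact.out : p.Prime).one_le
  have hs := sum_choose_sq_eq_zero (p := p) (l := l) (by omega)
  have hr : range p = range (p - 1 + 1) := by rw [Nat.sub_add_cancel hp]
  rw [hr, sum_range_succ, choose_pred_prime_sq (by omega)] at hs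
  rw [sum_congr rfl h, ← mul_sum, sum_Ico_eq_sum_range]
  simp only [Nat.add_sub_cancel_left]
  linear_combination (((l + 1 : ℕ) : ZMod p) ^ 2)⁻¹ * hs

lemma centralBinom_eq_zero_zmod {k : ℕ} (hk : k ∈ Ico ((p + 1) / 2) p) :
    (k.centralBinom : ZMod p) = 0 := by
  obtain ⟨h1, h2⟩ := mem_Ico.1 hk
  rw [ZMod.natCast_eq_zero_iff, Nat.centralBinom, two_mul]
  exact (Fact.out : p.Prime).dvd_choose_add h2 h2 (by omega)

lemma sum_g_neg_one_mul_inv_sq (hp : 5 < p) :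
    ∑ n ∈ Ico 1 p, (g (-1) n : ZMod p) * ((n : ZMod p) ^ 2)⁻¹ = 0 := by
  have hg : ∀ n ∈ Ico 1 p, (g (-1) n : ZMod p) * ((n : ZMod p) ^ 2)⁻¹ =
      ∑ k ∈ range p, (-1) ^ k * (k.centralBinom : ZMod p) *
        ((n.choose k : ZMod p) ^ 2 * ((n : ZMod p) ^ 2)⁻¹) := by
    intro n hn
    have hn := (mem_Ico.1 hn).2
    rw [g, Int.cast_sum, sum_mul]
    refine (sum_congr rfl fun k _ => ?_).trans
      (sum_subset (range_subset_range.2 (by omega : n + 1 ≤ p)) ?_)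
    · rw [Nat.centralBinom]
      push_cast
      ring
    · intro k _ hk
      rw [Nat.choose_eq_zero_of_lt (by rw [mem_range] at hk; omega)]
      simp
  have hp2 : Odd p := (Fact.out : p.Prime).odd_of_ne_two (by omega)
  rw [sum_congr rfl hg, sum_comm, range_eq_Ico,
    ← sum_Ico_consecutive _ (Nat.zero_le ((p + 1) / 2)) (by omega),
    sum_eq_sum_Ico_succ_bot (by omega)]
  simp only [← mul_sum]
  rw [sum_eq_zero (s := Ico ((p + 1) / 2) p), add_zero, zero_add]
  · simp only [Nat.choose_zero_right, Nat.cast_one, one_pow, one_mul]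
    rw [sum_inv_sq_eq_zero (by omega), mul_zero, zero_add, ← neg_eq_zero,
      ← sum_alternating_centralBinom_eq_zero hp hp2, ← sum_neg_distrib]
    refine sum_congr rfl fun k hk => ?_
    rw [sum_choose_sq_mul_inv_sq hk]
    ring
  · intro k hk
    rw [centralBinom_eq_zero_zmod hk]
    simp

end ModPrime

section ModPrimeSq

/-- The number `(p - 1 choose k) (p - 1 + k choose k)`. -/
def aperyCoeff (p k : ℕ) : ℕ := (p - 1).choose k * (p - 1 + k).choose k

lemma aperyCoeff_succ {p k : ℕ} (hk : k + 1 < p) :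
    aperyCoeff p (k + 1) * (k + 1) ^ 2 = aperyCoeff p k * ((p - 1 - k) * (p + k)) := by
  have h1 := Nat.choose_succ_right_eq (p - 1) k
  have h2 := Nat.add_one_mul_choose_eq (p - 1 + k) k
  rw [show p - 1 + k + 1 = p + k by omega] at h2
  rw [aperyCoeff, aperyCoeff, show p - 1 + (k + 1) = p + k by omega]
  calc _ = ((p - 1).choose (k + 1) * (k + 1)) * ((p + k).choose (k + 1) * (k + 1)) := by ring
    _ = _ := by rw [h1, ← h2]; ring

variable {p : ℕ} [Fact p.Prime]

lemma isUnit_natCast_of_mem_Ico (m : ℕ) {k : ℕ} (hk : k ∈ Ico 1 p) :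
    IsUnit (k : ZMod (p ^ m)) := by
  rw [ZMod.isUnit_iff_coprime]
  exact (Nat.coprime_of_lt_prime (by have := (mem_Ico.1 hk).1; omega) (mem_Ico.1 hk).2
    Fact.out).symm.pow_right m

lemma natCast_mul_inv_of_mem_Ico (m : ℕ) {k : ℕ} (hk : k ∈ Ico 1 p) :
    (k : ZMod (p ^ m)) * (k : ZMod (p ^ m))⁻¹ = 1 :=
  ZMod.mul_inv_of_unit _ (isUnit_natCast_of_mem_Ico m hk)

/-- Up to sign, `aperyCoeff p k` is `p` times `(k - p) / k²` modulo `p²`. -/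
lemma aperyCoeff_eq {k : ℕ} (hk : k + 1 < p) : ∃ q : ℕ, aperyCoeff p (k + 1) = p * q ∧
    (-1 : ZMod (p ^ 2)) ^ (k + 1) * q * ((k + 1 : ℕ) : ZMod (p ^ 2)) ^ 2 =
      ((k + 1 : ℕ) : ZMod (p ^ 2)) - p := by
  have hpp : (p : ZMod (p ^ 2)) ^ 2 = 0 := by exact_mod_cast ZMod.natCast_self (p ^ 2)
  induction k with
  | zero =>
    refine ⟨p - 1, ?_, ?_⟩
    · rw [aperyCoeff, zero_add, Nat.choose_one_right, Nat.choose_one_right,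
        Nat.sub_add_cancel (by omega), mul_comm]
    · rw [Nat.cast_sub (by omega)]
      simp
  | succ k ih =>
    obtain ⟨q, hq, hq'⟩ := ih (by omega)
    have h := aperyCoeff_succ hk
    rw [hq] at h
    have hp := (Fact.out : p.Prime)
    have hdvd : p ∣ aperyCoeff p (k + 1 + 1) := by
      have hc : Nat.Coprime p ((k + 1 + 1) ^ 2) :=
        (Nat.coprime_of_lt_prime (by omega) hk hp).pow_right 2
      exact hc.dvd_of_dvd_mul_right (h ▸ (dvd_mul_right p q).mul_right _)
    obtain ⟨r, hr⟩ := hdvd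
    refine ⟨r, hr, ?_⟩
    rw [hr, mul_assoc, mul_assoc] at h
    have h := congrArg (Nat.cast : ℕ → ZMod (p ^ 2)) (Nat.eq_of_mul_eq_mul_left hp.pos h)
    rw [Nat.cast_mul, Nat.cast_mul, Nat.cast_mul, Nat.sub_sub, Nat.cast_sub (by omega)] at h
    have hu := (isUnit_natCast_of_mem_Ico (p := p) 2 (k := k + 1)
      (mem_Ico.2 ⟨by omega, by omega⟩)).pow 2
    refine hu.mul_left_cancel ?_
    push_cast at h hq' ⊢
    set c := (-1 : ZMod (p ^ 2)) ^ (k + 1) with hc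
    rw [pow_succ _ (k + 1), ← hc]
    linear_combination -c * (k + 1) ^ 2 * h - (p - (1 + (k + 1))) * (p + (k + 1)) * hq' +
      (p - (1 + (k + 1))) * hpp

lemma natCast_mul_eq_zero_of_castHom {x : ZMod (p ^ 2)}
    (hx : ZMod.castHom (dvd_pow_self p two_ne_zero) (ZMod p) x = 0) : (p : ZMod (p ^ 2)) * x = 0 := by
  rw [← ZMod.natCast_zmod_val x, map_natCast, ZMod.natCast_eq_zero_iff] at hx
  obtain ⟨c, hc⟩ := hx
  have hpp : ((p ^ 2 : ℕ) : ZMod (p ^ 2)) = 0 := ZMod.natCast_self (p ^ 2)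
  rw [← ZMod.natCast_zmod_val x, hc, Nat.cast_mul, ← mul_assoc, ← sq, ← Nat.cast_pow, hpp, zero_mul]

lemma sum_g_neg_one_mul_inv (hp : 5 < p) :
    ∑ k ∈ Ico 1 p, (g (-1) k : ZMod (p ^ 2)) * (k : ZMod (p ^ 2))⁻¹ = 0 := by
  have hp2 : Odd p := (Fact.out : p.Prime).odd_of_ne_two (by omega)
  have hex : ∀ k, ∃ q : ℕ, k ∈ Ico 1 p → aperyCoeff p k = p * q ∧
      (-1 : ZMod (p ^ 2)) ^ k * q * (k : ZMod (p ^ 2)) ^ 2 = (k : ZMod (p ^ 2)) - p := by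
    intro k
    by_cases hk : k ∈ Ico 1 p
    · obtain ⟨l, rfl⟩ := Nat.exists_eq_add_of_le' (mem_Ico.1 hk).1
      obtain ⟨q, hq⟩ := aperyCoeff_eq (mem_Ico.1 hk).2
      exact ⟨q, fun _ => hq⟩
    · exact ⟨0, fun h => absurd h hk⟩
  choose q hq using hex
  have hint : ∑ k ∈ Ico 1 p, (-1) ^ k * (q k : ℤ) * g (-1) k =
      p * ∑ k ∈ Ico 1 p, (-1) ^ k * (q k : ℤ) ^ 2 := by
    have h := sum_choose_mul_g (-1) (p - 1)
    have hp0 : 0 < p := by omega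
    rw [Nat.sub_add_cancel (by omega), range_eq_Ico, sum_eq_sum_Ico_succ_bot hp0,
      sum_eq_sum_Ico_succ_bot hp0] at h
    have he : Even (p - 1) := hp2.tsub_odd odd_one
    simp only [pow_add, he.neg_one_pow, one_mul] at h
    have hg0 : g (-1) 0 = 1 := by simp [g]
    simp only [pow_zero, Nat.choose_zero_right, hg0, zero_add, Nat.cast_one, one_pow, mul_one,
      add_right_inj] at h
    have hp0 : (p : ℤ) ≠ 0 := by exact_mod_cast (Fact.out : p.Prime).ne_zero
    refine mul_left_cancel₀ hp0 ?_
    have hw : ∀ k ∈ Ico 1 p,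
        (((p - 1).choose k * (p - 1 + k).choose k : ℕ) : ℤ) = p * q k := fun k hk => by
      exact_mod_cast (hq k hk).1
    rw [mul_sum, mul_sum, mul_sum]
    refine (sum_congr rfl fun k hk => ?_).trans (h.trans (sum_congr rfl fun k hk => ?_))
    · rw [hw k hk]
      ring
    · rw [hw k hk]
      ring
  have hR := congrArg (Int.cast : ℤ → ZMod (p ^ 2)) hint
  push_cast at hR
  set ι : ℕ → ZMod (p ^ 2) := fun k => (k : ZMod (p ^ 2))⁻¹ with hι
  have hinv : ∀ k ∈ Ico 1 p, (k : ZMod (p ^ 2)) * ι k = 1 := fun k hk =>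
    natCast_mul_inv_of_mem_Ico 2 hk
  have hqι : ∀ k ∈ Ico 1 p, (-1 : ZMod (p ^ 2)) ^ k * q k = ι k - p * ι k ^ 2 := fun k hk => by
    linear_combination ι k ^ 2 * (hq k hk).2 -
      (((-1) ^ k * q k) * (k * ι k + 1) - ι k) * hinv k hk
  have hz : (p : ZMod (p ^ 2)) * (∑ k ∈ Ico 1 p, (g (-1) k : ZMod (p ^ 2)) * ι k ^ 2 +
      ∑ k ∈ Ico 1 p, (-1) ^ k * (q k : ZMod (p ^ 2)) ^ 2) = 0 := by
    apply natCast_mul_eq_zero_of_castHom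
    set π := ZMod.castHom (dvd_pow_self p two_ne_zero) (ZMod p)
    have hπ : ∀ k ∈ Ico 1 p, π (ι k) = (k : ZMod p)⁻¹ := fun k hk => by
      have := congrArg π (hinv k hk)
      rw [map_mul, map_natCast, map_one] at this
      exact eq_inv_of_mul_eq_one_right this
    have hπq : ∀ k ∈ Ico 1 p, (-1 : ZMod p) ^ k * (q k : ZMod p) = (k : ZMod p)⁻¹ := fun k hk => by
      have := congrArg π (hqι k hk)
      simpa [hπ k hk] using this
    simp only [map_add, map_sum, map_mul, map_pow, map_neg, map_one, map_natCast, map_intCast]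
    have h1 := sum_g_neg_one_mul_inv_sq hp
    have h2 := sum_alternating_inv_sq_eq_zero (F := ZMod p) hp2
    rw [← add_zero (0 : ZMod p)]
    nth_rewrite 1 [← h1]
    rw [← h2]
    congr 1
    · exact sum_congr rfl fun k hk => by rw [hπ k hk, inv_pow]
    · refine sum_congr rfl fun k hk => ?_
      have hs : ((-1 : ZMod p) ^ k) ^ 2 = 1 := by rw [← pow_mul, mul_comm, pow_mul]; simp
      rw [← inv_pow, ← hπq k hk, mul_pow, hs, one_mul]
  rw [mul_add, ← hR, mul_sum, ← sum_add_distrib] at hz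
  rw [← hz]
  refine sum_congr rfl fun k hk => ?_
  rw [hqι k hk]
  ring

/-- A rational sum `∑ f k / k` over `0 < k < p` is divisible by `pᵐ` if its reduction vanishes. -/
lemma ratCongr_sum_div {f : ℕ → ℤ} {m : ℕ}
    (hf : ∑ k ∈ Ico 1 p, (f k : ZMod (p ^ m)) * (k : ZMod (p ^ m))⁻¹ = 0) :
    ratCongr p m (∑ k ∈ Ico 1 p, (f k : ℚ) / k) 0 := by
  have hd : ∀ k ∈ Ico 1 p, k * ((p - 1).factorial / k) = (p - 1).factorial := fun k hk => by
    obtain ⟨h1, h2⟩ := mem_Ico.1 hk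
    exact Nat.mul_div_cancel' (Nat.dvd_factorial h1 (by omega))
  set N : ℤ := ∑ k ∈ Ico 1 p, f k * ((p - 1).factorial / k : ℕ) with hN
  have hD : ((p - 1).factorial : ℚ) ≠ 0 := Nat.cast_ne_zero.2 (Nat.factorial_ne_zero _)
  have hsum : ∑ k ∈ Ico 1 p, (f k : ℚ) / k = N / ((p - 1).factorial : ℕ) := by
    rw [hN, eq_div_iff hD, sum_mul]
    rw [Int.cast_sum]
    refine sum_congr rfl fun k hk => ?_
    rw [Int.cast_mul, Int.cast_natCast]
    have hk0 : (k : ℚ) ≠ 0 := Nat.cast_ne_zero.2 (by have := (mem_Ico.1 hk).1; omega)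
    have h : (k : ℚ) * ((p - 1).factorial / k : ℕ) = (p - 1).factorial := by
      exact_mod_cast hd k hk
    rw [← h]
    field_simp
  have hdvd : (p : ℤ) ^ m ∣ N := by
    rw [← Nat.cast_pow, ← ZMod.intCast_zmod_eq_zero_iff_dvd, hN, Int.cast_sum,
      ← mul_zero ((p - 1).factorial : ZMod (p ^ m)), ← hf, mul_sum]
    refine sum_congr rfl fun k hk => ?_
    rw [← hd k hk, Nat.cast_mul, hd k hk, Int.cast_mul, Int.cast_natCast]
    linear_combination -(f k : ZMod (p ^ m)) * ((p - 1).factorial / k : ℕ) *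
      natCast_mul_inv_of_mem_Ico m hk
  rw [hsum]
  rcases eq_or_ne N 0 with h0 | h0
  · left
    simp [h0]
  right
  have hv : ¬ p ∣ (p - 1).factorial := by
    rw [(Fact.out : p.Prime).dvd_factorial]
    have := (Fact.out : p.Prime).pos
    omega
  rw [sub_zero, padicValRat.div (Int.cast_ne_zero.2 h0) hD, padicValRat.of_int, padicValRat.of_nat,
    padicValNat.eq_zero_of_not_dvd hv, Nat.cast_zero, sub_zero, Nat.cast_le]
  exact ((padicValInt_dvd_iff m N).1 hdvd).resolve_left h0

end ModPrimeSq

theorem sum_g_neg_one_div (p : ℕ) (hp : p.Prime) (hp5 : 5 < p) :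
    ratCongr p 2 (∑ k ∈ Finset.Icc 1 (p - 1), (g (-1) k : ℚ) / (k : ℚ)) 0 := by
  have : Fact p.Prime := ⟨hp⟩
  have hI : Finset.Icc 1 (p - 1) = Finset.Ico 1 p := by
    ext
    simp only [Finset.mem_Icc, Finset.mem_Ico]
    omega
  rw [hI]
  exact ratCongr_sum_div (sum_g_neg_one_mul_inv hp5)
end
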